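/- arXiv:2506.17867 — 13 statements merged into one kernel-verified Lean document; each statement's English description precedes it below -/
import Mathlib

section
/- Let r > 0 and θ ∈ ℝ, set s = cos θ, t = sin θ, and let y := (r·s, r·t) ∈ ℝ² be a row vector. Let g₁, g₂, v ∈ ℝ² be row vectors and let S₁, S₂, S_V be symmetric real 2×2 matrices. Define: G as the 2×2 matrix whose first row is g₁ and second row is g₂; M := g₁ᵀg₁ + g₂ᵀg₂ + y₁·S₁ + y₂·S₂ + S_V (where gᵀg denotes the outer product of a row vector with itself); the symmetric 4×4 block matrix Hess := [[I₂, G], [Gᵀ, M]]; the 2×2 matrix J := [[0, −1], [1, 0]]; the row vectors X₁ := (y·Jᵀ, 0, 0), X₂ := (−(y·G + v), y), X₃ := ((y·G + v)·J, y·J) in ℝ⁴; and the 3×3 matrix W with entries W_{ij} = X_i · Hess · X_jᵀ. Then det W = r⁴ · det( r²·(s·S₁ + t·S₂) + r·S_V + r⁻¹·vᵀv ). -/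
open Matrix

theorem dotProduct_fromBlocks_gram_mulVec {m n R : Type*} [Fintype m] [Fintype n]
    [DecidableEq m] [CommRing R] (G : Matrix m n R) (N : Matrix n n R)
    (a : m → R) (b : n → R) (a' : m → R) (b' : n → R) :
    Sum.elim a b ⬝ᵥ (fromBlocks 1 G Gᵀ (Gᵀ * G + N) *ᵥ Sum.elim a' b') =
      (a + G *ᵥ b) ⬝ᵥ (a' + G *ᵥ b') + b ⬝ᵥ (N *ᵥ b') := by
  have h (c : m → R) : b ⬝ᵥ (Gᵀ *ᵥ c) = (G *ᵥ b) ⬝ᵥ c := by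
    rw [dotProduct_mulVec, vecMul_transpose]
  simp only [fromBlocks_mulVec, sumElim_dotProduct_sumElim, Sum.elim_comp_inl, Sum.elim_comp_inr,
    one_mulVec, add_mulVec, ← mulVec_mulVec, dotProduct_add, add_dotProduct, h]
  ring

/-- In an orthonormal frame `(s, t)`, `(-t, s)` of the plane, Schur elimination of `r • (-t, s)`. -/
theorem det_gram_add_form {r s t : ℝ} (hst : s ^ 2 + t ^ 2 = 1) (hr : r ≠ 0)
    (u w v : Fin 2 → ℝ) (N : Matrix (Fin 2) (Fin 2) ℝ) (hN : N 1 0 = N 0 1)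
    (hu : s * u 0 + t * u 1 = -(s * v 0 + t * v 1))
    (hw : s * w 0 + t * w 1 = -(t * v 0 - s * v 1)) :
    (of fun i j => ![![-(r * t), r * s], u, w] i ⬝ᵥ ![![-(r * t), r * s], u, w] j +
      ![0, ![r * s, r * t], ![r * t, -(r * s)]] i ⬝ᵥ
        (N *ᵥ ![0, ![r * s, r * t], ![r * t, -(r * s)]] j) : Matrix (Fin 3) (Fin 3) ℝ).det =
      r ^ 6 * (N + (r⁻¹ * r⁻¹) • vecMulVec v v).det := by
  obtain ⟨p, hp⟩ : ∃ p, p = s * u 1 - t * u 0 := ⟨_, rfl⟩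
  obtain ⟨q, hq⟩ : ∃ q, q = s * w 1 - t * w 0 := ⟨_, rfl⟩
  have hu0 : u 0 = -s * (s * v 0 + t * v 1) - t * p := by
    linear_combination s * hu + t * hp - u 0 * hst
  have hu1 : u 1 = -t * (s * v 0 + t * v 1) + s * p := by
    linear_combination t * hu - s * hp - u 1 * hst
  have hw0 : w 0 = -s * (t * v 0 - s * v 1) - t * q := by
    linear_combination s * hw + t * hq - w 0 * hst
  have hw1 : w 1 = -t * (t * v 0 - s * v 1) + s * q := by
    linear_combination t * hw - s * hq - w 1 * hst
  have huu : u ⬝ᵥ u = (s * v 0 + t * v 1) ^ 2 + p ^ 2 := by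
    rw [dotProduct, Fin.sum_univ_two, hu0, hu1]
    linear_combination ((s * v 0 + t * v 1) ^ 2 + p ^ 2) * hst
  have huw : u ⬝ᵥ w = (s * v 0 + t * v 1) * (t * v 0 - s * v 1) + p * q := by
    rw [dotProduct, Fin.sum_univ_two, hu0, hu1, hw0, hw1]
    linear_combination ((s * v 0 + t * v 1) * (t * v 0 - s * v 1) + p * q) * hst
  have hww : w ⬝ᵥ w = (t * v 0 - s * v 1) ^ 2 + q ^ 2 := by
    rw [dotProduct, Fin.sum_univ_two, hw0, hw1]
    linear_combination ((t * v 0 - s * v 1) ^ 2 + q ^ 2) * hst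
  have hee : ![-(r * t), r * s] ⬝ᵥ ![-(r * t), r * s] = r ^ 2 := by
    simp only [dotProduct, Fin.sum_univ_two, cons_val_zero, cons_val_one]
    linear_combination r ^ 2 * hst
  have heu : ![-(r * t), r * s] ⬝ᵥ u = r * p := by
    simp only [dotProduct, Fin.sum_univ_two, cons_val_zero, cons_val_one, hp]
    ring
  have hew : ![-(r * t), r * s] ⬝ᵥ w = r * q := by
    simp only [dotProduct, Fin.sum_univ_two, cons_val_zero, cons_val_one, hq]
    ring
  simp only [det_fin_three, of_apply, cons_val, zero_dotProduct, mulVec_zero, dotProduct_zero,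
    dotProduct_comm w u, dotProduct_comm u ![-(r * t), r * s],
    dotProduct_comm w ![-(r * t), r * s], huu, huw, hww, hee, heu, hew]
  simp only [det_fin_two, dotProduct, mulVec, Fin.sum_univ_two, cons_val_zero, cons_val_one,
    Matrix.add_apply, Matrix.smul_apply, smul_eq_mul, vecMulVec_apply, hN]
  field_simp
  linear_combination (s ^ 2 + t ^ 2 + 1) * r ^ 2 * ((r ^ 2 * N 0 0 + v 0 ^ 2) *
    (r ^ 2 * N 1 1 + v 1 ^ 2) - (r ^ 2 * N 0 1 + v 0 * v 1) ^ 2) * hst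

/-- Algebraic core of the convexity criterion for magnetic Hamiltonians:
the determinant of the tangent Hessian `W` in the frame `X₁, X₂, X₃` equals
`r⁴ · det U_W` where `U_W = r²(s·S₁ + t·S₂) + r·S_V + r⁻¹·vᵀv`. -/
theorem det_tangent_hessian_eq
    (r θ : ℝ) (hr : 0 < r)
    (g₁ g₂ v : Fin 2 → ℝ)
    (S₁ S₂ SV : Matrix (Fin 2) (Fin 2) ℝ)
    (hS₁ : S₁.IsSymm) (hS₂ : S₂.IsSymm) (hSV : SV.IsSymm) :
    let s : ℝ := Real.cos θ
    let t : ℝ := Real.sin θ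
    let y : Fin 2 → ℝ := ![r * s, r * t]
    let G : Matrix (Fin 2) (Fin 2) ℝ := Matrix.of ![g₁, g₂]
    let M : Matrix (Fin 2) (Fin 2) ℝ :=
      vecMulVec g₁ g₁ + vecMulVec g₂ g₂ + y 0 • S₁ + y 1 • S₂ + SV
    let Hess : Matrix (Fin 2 ⊕ Fin 2) (Fin 2 ⊕ Fin 2) ℝ :=
      Matrix.fromBlocks 1 G Gᵀ M
    let J : Matrix (Fin 2) (Fin 2) ℝ := !![0, -1; 1, 0]
    let X₁ : Fin 2 ⊕ Fin 2 → ℝ := Sum.elim (y ᵥ* Jᵀ) (0 : Fin 2 → ℝ)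
    let X₂ : Fin 2 ⊕ Fin 2 → ℝ := Sum.elim (-(y ᵥ* G + v)) y
    let X₃ : Fin 2 ⊕ Fin 2 → ℝ := Sum.elim ((y ᵥ* G + v) ᵥ* J) (y ᵥ* J)
    let X : Fin 3 → (Fin 2 ⊕ Fin 2 → ℝ) := ![X₁, X₂, X₃]
    let W : Matrix (Fin 3) (Fin 3) ℝ := Matrix.of fun i j => X i ⬝ᵥ (Hess *ᵥ X j)
    W.det = r ^ 4 * (r ^ 2 • (s • S₁ + t • S₂) + r • SV + r⁻¹ • vecMulVec v v).det := by
  intro s t y G M Hess J X₁ X₂ X₃ X W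
  have hst : s ^ 2 + t ^ 2 = 1 := Real.cos_sq_add_sin_sq θ
  clear_value s t
  set N : Matrix (Fin 2) (Fin 2) ℝ := y 0 • S₁ + y 1 • S₂ + SV with hN
  have hNsymm : N 1 0 = N 0 1 := by
    simp only [hN, Matrix.add_apply, Matrix.smul_apply, hS₁.apply 0 1, hS₂.apply 0 1,
      hSV.apply 0 1]
  have hM : M = Gᵀ * G + N := by
    ext i j
    simp [M, G, hN, vecMulVec_apply, Matrix.mul_apply, Fin.sum_univ_two]
    ring
  have hW : W.det = r ^ 6 * (N + (r⁻¹ * r⁻¹) • vecMulVec v v).det := by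
    set b₂ : Fin 2 → ℝ := y ᵥ* J with hb₂
    have entry : ∀ a b a' b' : Fin 2 → ℝ,
        Sum.elim a b ⬝ᵥ (Hess *ᵥ Sum.elim a' b') =
          (a + G *ᵥ b) ⬝ᵥ (a' + G *ᵥ b') + b ⬝ᵥ (N *ᵥ b') := by
      intro a b a' b'
      simp only [Hess, hM]
      exact dotProduct_fromBlocks_gram_mulVec G N a b a' b'
    have hdet := det_gram_add_form hst hr.ne' (-(y ᵥ* G + v) + G *ᵥ y)
      ((y ᵥ* G + v) ᵥ* J + G *ᵥ b₂) v N hNsymm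
      (by
        refine mul_left_cancel₀ hr.ne' ?_
        simp only [y, G, vecMul, dotProduct, mulVec, Fin.sum_univ_two, Pi.add_apply,
          Pi.neg_apply, of_apply, cons_val_zero, cons_val_one]
        ring)
      (by
        simp only [y, G, J, hb₂, vecMul, dotProduct, mulVec, Fin.sum_univ_two, Pi.add_apply,
          of_apply, cons_val', cons_val_zero, cons_val_one, cons_val_fin_one]
        ring)
    rw [← hdet]
    congr 1
    have hX₁ : y ᵥ* Jᵀ + G *ᵥ 0 = ![-(r * t), r * s] := by
      ext i; fin_cases i <;> simp [y, J, vecMul, dotProduct, Fin.sum_univ_two]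
    have hb : b₂ = ![r * t, -(r * s)] := by
      ext i; fin_cases i <;> simp [y, J, hb₂]
    rw [← hX₁, ← hb]
    let A : Fin 3 → Fin 2 → ℝ := ![y ᵥ* Jᵀ, -(y ᵥ* G + v), (y ᵥ* G + v) ᵥ* J]
    let B : Fin 3 → Fin 2 → ℝ := ![0, y, b₂]
    let U : Fin 3 → Fin 2 → ℝ :=
      ![y ᵥ* Jᵀ + G *ᵥ 0, -(y ᵥ* G + v) + G *ᵥ y, (y ᵥ* G + v) ᵥ* J + G *ᵥ b₂]
    have hX (i) : X i = Sum.elim (A i) (B i) := by fin_cases i <;> rfl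
    have hAB (i) : A i + G *ᵥ B i = U i := by fin_cases i <;> rfl
    ext i j
    change X i ⬝ᵥ (Hess *ᵥ X j) = U i ⬝ᵥ U j + B i ⬝ᵥ (N *ᵥ B j)
    rw [hX i, hX j, entry, hAB, hAB]
  rw [hW]
  have hU : r ^ 2 • (s • S₁ + t • S₂) + r • SV + r⁻¹ • vecMulVec v v =
      r • (N + (r⁻¹ * r⁻¹) • vecMulVec v v) := by
    ext i j
    simp [hN, y]
    field_simp
  rw [hU, det_smul, Fintype.card_fin]
  ring
end

section
/- Let g₁, g₂, v ∈ ℝ² be row vectors and let S_V be a symmetric real 2×2 matrix. Define G as the 2×2 matrix whose first row is g₁ and second row is g₂, M₀ := g₁ᵀg₁ + g₂ᵀg₂ + S_V, and the symmetric 4×4 block matrix Hess := [[I₂, G], [Gᵀ, M₀]]. Let X₁ := (1,0,0,0), X₂ := (0,1,0,0), X₃ := (0, 0, v₂, −v₁), and let W_b be the 3×3 matrix with entries (W_b)_{ij} = X_i · Hess · X_jᵀ. Then det W_b = (S_V)₂₂·v₁² + (S_V)₁₁·v₂² − 2·(S_V)₁₂·v₁·v₂. In particular, det W_b does not depend on g₁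 and g₂. -/
open Matrix

/-- Boundary case of the convexity criterion for magnetic Hamiltonians:
at a zero-velocity point, the determinant of the tangent Hessian in the frame
`X₁ = (1,0,0,0)`, `X₂ = (0,1,0,0)`, `X₃ = (0,0,v₂,−v₁)` equals
`(S_V)₂₂v₁² + (S_V)₁₁v₂² − 2(S_V)₁₂v₁v₂`, independently of `g₁, g₂`. -/
theorem det_tangent_hessian_boundary
    (g₁ g₂ v : Fin 2 → ℝ)
    (SV : Matrix (Fin 2) (Fin 2) ℝ) (hSV : SV.IsSymm) :
    let G : Matrix (Fin 2) (Fin 2) ℝ := Matrix.of ![g₁, g₂]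
    let M₀ : Matrix (Fin 2) (Fin 2) ℝ := vecMulVec g₁ g₁ + vecMulVec g₂ g₂ + SV
    let Hess : Matrix (Fin 2 ⊕ Fin 2) (Fin 2 ⊕ Fin 2) ℝ :=
      Matrix.fromBlocks 1 G Gᵀ M₀
    let X₁ : Fin 2 ⊕ Fin 2 → ℝ := Sum.elim ![1, 0] (0 : Fin 2 → ℝ)
    let X₂ : Fin 2 ⊕ Fin 2 → ℝ := Sum.elim ![0, 1] (0 : Fin 2 → ℝ)
    let X₃ : Fin 2 ⊕ Fin 2 → ℝ := Sum.elim (0 : Fin 2 → ℝ) ![v 1, -(v 0)]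
    let X : Fin 3 → (Fin 2 ⊕ Fin 2 → ℝ) := ![X₁, X₂, X₃]
    let Wb : Matrix (Fin 3) (Fin 3) ℝ := Matrix.of fun i j => X i ⬝ᵥ (Hess *ᵥ X j)
    Wb.det = SV 1 1 * (v 0) ^ 2 + SV 0 0 * (v 1) ^ 2 - 2 * SV 0 1 * v 0 * v 1 := by
  have h : SV 1 0 = SV 0 1 := hSV.apply 0 1
  intro G M₀ Hess X₁ X₂ X₃ X Wb
  simp [Wb, X, X₁, X₂, X₃, Hess, M₀, G, det_fin_three, dotProduct, mulVec, fromBlocks,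
    Fin.sum_univ_two, vecMulVec_apply, h, Matrix.one_apply]
  ring
end

section
/- For every r ∈ [0, 1], (15 − 14r + 11r² + 6r³ − 3r⁴)² − 16·((1 − r)² + (2 − r)r³)·((3 − r)² + 4r² + (2 − r)r³) > 0. Equivalently, substituting r = ν + 1/2, this difference equals 19433/256 + (123/16)ν² + (307/8)ν⁴ + 51ν⁶ − 7ν⁸, which is positive for all ν ∈ [−1/2, 1/2]. -/
/-- Polynomial inequality ruling out strict convexity for mass ratios `μ ≠ 1/2`:
for `r ∈ [0,1]` the stated polynomial expression is positive; equivalently,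
substituting `r = ν + 1/2`, it equals
`19433/256 + (123/16)ν² + (307/8)ν⁴ + 51ν⁶ − 7ν⁸`, which is positive on `[-1/2, 1/2]`. -/
theorem poly_positivity_nonconvexity :
    (∀ r ∈ Set.Icc (0 : ℝ) 1,
      0 < (15 - 14*r + 11*r^2 + 6*r^3 - 3*r^4)^2
          - 16 * ((1 - r)^2 + (2 - r)*r^3) * ((3 - r)^2 + 4*r^2 + (2 - r)*r^3)) ∧
    (∀ ν : ℝ,
      (15 - 14*(ν + 1/2) + 11*(ν + 1/2)^2 + 6*(ν + 1/2)^3 - 3*(ν + 1/2)^4)^2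
          - 16 * ((1 - (ν + 1/2))^2 + (2 - (ν + 1/2))*(ν + 1/2)^3)
              * ((3 - (ν + 1/2))^2 + 4*(ν + 1/2)^2 + (2 - (ν + 1/2))*(ν + 1/2)^3)
        = 19433/256 + (123/16)*ν^2 + (307/8)*ν^4 + 51*ν^6 - 7*ν^8) ∧
    (∀ ν ∈ Set.Icc (-(1:ℝ)/2) (1/2),
      0 < 19433/256 + (123/16)*ν^2 + (307/8)*ν^4 + 51*ν^6 - 7*ν^8) := by
  have expand : ∀ ν : ℝ,
      (15 - 14*(ν + 1/2) + 11*(ν + 1/2)^2 + 6*(ν + 1/2)^3 - 3*(ν + 1/2)^4)^2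
          - 16 * ((1 - (ν + 1/2))^2 + (2 - (ν + 1/2))*(ν + 1/2)^3)
              * ((3 - (ν + 1/2))^2 + 4*(ν + 1/2)^2 + (2 - (ν + 1/2))*(ν + 1/2)^3)
        = 19433/256 + (123/16)*ν^2 + (307/8)*ν^4 + 51*ν^6 - 7*ν^8 := fun ν => by ring
  have pos : ∀ ν ∈ Set.Icc (-(1:ℝ)/2) (1/2),
      0 < 19433/256 + (123/16)*ν^2 + (307/8)*ν^4 + 51*ν^6 - 7*ν^8 := by
    rintro ν ⟨hl, hu⟩
    have hsq : ν^2 ≤ 1 := by nlinarith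
    have hpow : ν^8 ≤ ν^6 := by
      calc ν^8 = ν^6 * ν^2 := by ring
        _ ≤ ν^6 := mul_le_of_le_one_right (by positivity) hsq
    have h2 : 0 ≤ ν^2 := by positivity
    have h4 : 0 ≤ ν^4 := by positivity
    have h6 : 0 ≤ ν^6 := by positivity
    linarith
  refine ⟨?_, expand, pos⟩
  rintro r ⟨h0, h1⟩
  have h := pos (r - 1/2) ⟨by linarith, by linarith⟩
  rwa [← expand, sub_add_cancel] at h
end

section
/- Define a(r₁) := (2 − r₁ + r₁²)/(1 − 2r₁ + r₁² + 2r₁³ − r₁⁴) for r₁ ∈ [0, 1] (the denominator equals (1 − r₁)² + r₁³(2 − r₁) and is positive on [0,1]). Then for every r₁ ∈ [0, 1] one has 2 ≤ a(r₁) ≤ 4; moreover a(1/2) = 4 and a(0) = a(1) = 2, so the maximum of a on [0,1] equals 4 and is attained at r₁ = 1/2, and the minimum equals 2 and is attained at the endpoints. -/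
/-- The coefficient `a(r₁) = (2 − r₁ + r₁²)/(1 − 2r₁ + r₁² + 2r₁³ − r₁⁴)` of the
Hessian of the effective potential at the first Lagrange point satisfies
`2 ≤ a(r₁) ≤ 4` on `[0,1]`, with maximum `4` attained at `r₁ = 1/2` and
minimum `2` attained at the endpoints. -/
theorem lagrange_coefficient_bounds :
    let d : ℝ → ℝ := fun r => 1 - 2*r + r^2 + 2*r^3 - r^4
    let a : ℝ → ℝ := fun r => (2 - r + r^2) / d r
    (∀ r ∈ Set.Icc (0 : ℝ) 1, d r = (1 - r)^2 + r^3 * (2 - r) ∧ 0 < d r) ∧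
    (∀ r ∈ Set.Icc (0 : ℝ) 1, 2 ≤ a r ∧ a r ≤ 4) ∧
    a (1/2) = 4 ∧ a 0 = 2 ∧ a 1 = 2 := by
  intro d a
  have hd : ∀ r, d r = 1 - 2 * (r * (1 - r)) - (r * (1 - r)) ^ 2 := fun r => by
    simp only [d]; ring
  have hs : ∀ r ∈ Set.Icc (0 : ℝ) 1, 0 ≤ r * (1 - r) ∧ r * (1 - r) ≤ 1 / 4 := fun r hr =>
    ⟨mul_nonneg hr.1 (sub_nonneg.2 hr.2), by nlinarith [sq_nonneg (2 * r - 1)]⟩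
  have hpos : ∀ r ∈ Set.Icc (0 : ℝ) 1, 0 < d r := fun r hr => by
    obtain ⟨h0, h1⟩ := hs r hr
    rw [hd]
    nlinarith
  refine ⟨fun r hr => ⟨by simp only [d]; ring, hpos r hr⟩, fun r hr => ?_, ?_, ?_, ?_⟩
  · have hn : 2 - r + r ^ 2 = 2 - r * (1 - r) := by ring
    obtain ⟨h0, h1⟩ := hs r hr
    simp only [a]
    rw [le_div_iff₀ (hpos r hr), div_le_iff₀ (hpos r hr), hn, hd]
    constructor <;> nlinarith
  all_goals norm_num [a, d]
end

section
/- Fix a ∈ [2, 4] and set u := √(a(9a − 4)), λ₁ := √(a − 1 + u), λ₂ := √(1 − a + u), C₀ := √2·(a(9a − 4))^{1/4}, C₁ := √(2 + 3a − u), C₂ := √(2 + 3a + u) (all of these are well defined and positive, since 2 + 3a − u > 0 and 1 − a + u > 0 for a ∈ [2,4]). Let V be the real 4×4 matrix with rows: row 1 = ((C₂² + 2a − 2)/(√λ₁·C₁·C₀), 0, 0, (C₁² + 2a − 2)/(√λ₂·C₂·C₀)); row 2 = (0, √λ₂·(C₂² − 2)/(C₂·C₀), √λ₁·(C₁² − 2)/(C₁·C₀),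 0); row 3 = (0, 2√λ₂/(C₂·C₀), 2√λ₁/(C₁·C₀), 0); row 4 = (C₁/(√λ₁·C₀), 0, 0, C₂/(√λ₂·C₀)). Let J₂ := [[0, −1], [1, 0]], let J₄ := [[0₂, −I₂], [I₂, 0₂]] in 2×2 blocks, and let A := [[I₂, J₂], [J₂ᵀ, diag(−4a, 2a)]] in 2×2 blocks. Then: (i) Vᵀ·J₄·V = J₄, i.e. V is a symplectic matrix; (ii) Vᵀ·A·V = diag(λ₁, λ₂, −λ₁, λ₂). -/
open Matrix

/-- The normal form identities, with the roots replaced by any nonzero reals satisfying the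
polynomial relations between them. -/
theorem normal_form_of_relations {a u m n c c₁ c₂ : ℝ} (hm : m ≠ 0) (hn : n ≠ 0)
    (hc : c ≠ 0) (hc₁ : c₁ ≠ 0) (hc₂ : c₂ ≠ 0) (hu2 : u ^ 2 = a * (9 * a - 4))
    (hm4 : m ^ 4 = a - 1 + u) (hn4 : n ^ 4 = 1 - a + u) (hc2 : c ^ 2 = 2 * u)
    (h1 : c₁ ^ 2 = 2 + 3 * a - u) (h2 : c₂ ^ 2 = 2 + 3 * a + u) :
    let V : Matrix (Fin 4) (Fin 4) ℝ :=
      !![(c₂ ^ 2 + 2 * a - 2) / (m * c₁ * c), 0, 0, (c₁ ^ 2 + 2 * a - 2) / (n * c₂ * c);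
         0, n * (c₂ ^ 2 - 2) / (c₂ * c), m * (c₁ ^ 2 - 2) / (c₁ * c), 0;
         0, 2 * n / (c₂ * c), 2 * m / (c₁ * c), 0;
         c₁ / (m * c), 0, 0, c₂ / (n * c)]
    let J : Matrix (Fin 4) (Fin 4) ℝ := !![0, 0, -1, 0; 0, 0, 0, -1; 1, 0, 0, 0; 0, 1, 0, 0]
    let A : Matrix (Fin 4) (Fin 4) ℝ :=
      !![1, 0, 0, -1; 0, 1, 1, 0; 0, 1, -4 * a, 0; -1, 0, 0, 2 * a]
    Vᵀ * J * V = J ∧ Vᵀ * A * V = diagonal ![m ^ 2, n ^ 2, -m ^ 2, n ^ 2] := by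
  intro V J A
  constructor
  · ext i j
    fin_cases i <;> fin_cases j <;>
      simp [V, J, Matrix.mul_apply, Fin.sum_univ_four] <;> field_simp <;>
      clear hm hn hc hc₁ hc₂ <;> grind
  · ext i j
    fin_cases i <;> fin_cases j <;>
      simp [V, A, Matrix.mul_apply, Fin.sum_univ_four, Matrix.diagonal] <;> field_simp <;>
      clear hm hn hc hc₁ hc₂ <;> grind

/-- The explicit matrix `V` is a symplectic change of coordinates bringing the
Hessian `A = ∇²H(l₁)` of the restricted three-body problem at the first Lagrange
point to the saddle-center normal form `diag(λ₁, λ₂, −λ₁, λ₂)`. -/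
theorem symplectic_normal_form (a : ℝ) (ha : a ∈ Set.Icc (2 : ℝ) 4) :
    let u : ℝ := Real.sqrt (a * (9*a - 4))
    let l1 : ℝ := Real.sqrt (a - 1 + u)
    let l2 : ℝ := Real.sqrt (1 - a + u)
    let C₀ : ℝ := Real.sqrt 2 * (a * (9*a - 4)) ^ ((1:ℝ)/4)
    let C₁ : ℝ := Real.sqrt (2 + 3*a - u)
    let C₂ : ℝ := Real.sqrt (2 + 3*a + u)
    let V : Matrix (Fin 4) (Fin 4) ℝ :=
      !![(C₂^2 + 2*a - 2) / (Real.sqrt l1 * C₁ * C₀), 0, 0,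
           (C₁^2 + 2*a - 2) / (Real.sqrt l2 * C₂ * C₀);
         0, Real.sqrt l2 * (C₂^2 - 2) / (C₂ * C₀),
           Real.sqrt l1 * (C₁^2 - 2) / (C₁ * C₀), 0;
         0, 2 * Real.sqrt l2 / (C₂ * C₀), 2 * Real.sqrt l1 / (C₁ * C₀), 0;
         C₁ / (Real.sqrt l1 * C₀), 0, 0, C₂ / (Real.sqrt l2 * C₀)]
    let J₄ : Matrix (Fin 4) (Fin 4) ℝ :=
      !![0, 0, -1, 0;
         0, 0, 0, -1;
         1, 0, 0, 0;
         0, 1, 0, 0]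
    let A : Matrix (Fin 4) (Fin 4) ℝ :=
      !![1, 0, 0, -1;
         0, 1, 1, 0;
         0, 1, -4*a, 0;
         -1, 0, 0, 2*a]
    0 < 2 + 3*a - u ∧ 0 < 1 - a + u ∧
    Vᵀ * J₄ * V = J₄ ∧
    Vᵀ * A * V = Matrix.diagonal ![l1, l2, -l1, l2] := by
  obtain ⟨ha2, -⟩ := ha
  intro u l1 l2 C₀ C₁ C₂ V J₄ A
  have hs : 0 < a * (9 * a - 4) := by nlinarith
  have hu : 0 < u := Real.sqrt_pos.2 hs
  have hu2 : u ^ 2 = a * (9 * a - 4) := Real.sq_sqrt hs.le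
  have h1 : 0 < 2 + 3 * a - u := by nlinarith
  have h2 : 0 < 2 + 3 * a + u := by linarith
  have h3 : 0 < 1 - a + u := by nlinarith
  have h4 : 0 < a - 1 + u := by linarith
  have hl1 : 0 < l1 := Real.sqrt_pos.2 h4
  have hl2 : 0 < l2 := Real.sqrt_pos.2 h3
  have hm2 : √l1 ^ 2 = l1 := Real.sq_sqrt hl1.le
  have hn2 : √l2 ^ 2 = l2 := Real.sq_sqrt hl2.le
  have hm4 : √l1 ^ 4 = a - 1 + u := by
    rw [show √l1 ^ 4 = (√l1 ^ 2) ^ 2 by ring, hm2]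
    exact Real.sq_sqrt h4.le
  have hn4 : √l2 ^ 4 = 1 - a + u := by
    rw [show √l2 ^ 4 = (√l2 ^ 2) ^ 2 by ring, hn2]
    exact Real.sq_sqrt h3.le
  have hC : 0 < C₀ := by positivity
  have hC2 : C₀ ^ 2 = 2 * u := by
    simp only [C₀, u, mul_pow, Real.sqrt_eq_rpow (a * _)]
    rw [Real.sq_sqrt zero_le_two, ← Real.rpow_mul_natCast hs.le]
    norm_num
  have key := normal_form_of_relations (Real.sqrt_pos.2 hl1).ne' (Real.sqrt_pos.2 hl2).ne'
    hC.ne' (Real.sqrt_pos.2 h1).ne' (Real.sqrt_pos.2 h2).ne' hu2 hm4 hn4 hC2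
    (Real.sq_sqrt h1.le) (Real.sq_sqrt h2.le)
  rw [hm2, hn2] at key
  exact ⟨h1, h3, key⟩
end

section
/- Let h ≤ −2 and let (x₁, x₂) ∈ ℝ² satisfy 0 ≤ x₁, cosh x₁ ≤ 19/10, 0 ≤ x₂ ≤ π/2, and V_h(x₁, x₂) ≤ 0. Set r := √(−2·V_h(x₁, x₂)). Then c₋₁ := −r·sinh x₁·cosh x₁ + V₁₁(x₁) > 0. Consequently, for every t ∈ [−1, 1], c_t := r·t·sinh x₁·cosh x₁ + V₁₁(x₁) ≥ c₋₁ > 0. -/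
open Real

/-- The potential of the regularized circular planar restricted three-body problem
at mass ratio `μ = 1/2` in elliptic-hyperbolic coordinates, with energy parameter `h`. -/
noncomputable def Vpot (h x₁ x₂ : ℝ) : ℝ :=
  -(h/4) * cosh x₁ ^ 2 - (1/2) * cosh x₁ - (1/128) * sinh (2*x₁) ^ 2
    + (h/4) * cos x₂ ^ 2 - (1/128) * sin (2*x₂) ^ 2

/-- First partial derivative `∂V/∂x₁`. -/
noncomputable def V₁ (h x₁ : ℝ) : ℝ :=
  -(1/32) * (16 + (1 + 16*h) * cosh x₁ + cosh (3*x₁)) * sinh x₁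

/-- Second partial derivative `∂²V/∂x₁²`. -/
noncomputable def V₁₁ (h x₁ : ℝ) : ℝ :=
  -(1/16) * (8 * cosh x₁ + 8*h * cosh (2*x₁) + cosh (4*x₁))

/-- The value of `V₁₁` at `h = -2` as a polynomial in `u = cosh x₁` is positive. -/
lemma quartic_pos {u : ℝ} (h1 : 1 ≤ u) (h2 : u ≤ 19/10) :
    0 < -(1/2) * u^4 + (5/2) * u^2 - (1/2) * u - 17/16 := by
  have ha : 0 ≤ u - 1 := by linarith
  have hb : 0 ≤ 19/10 - u := by linarith
  have key (i j : ℕ) : 0 ≤ (u - 1)^i * (19/10 - u)^j := by positivity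
  linarith [key 0 4, key 1 3, key 2 2, key 3 1, key 4 0]

/-- The comparison of squares behind `c_neg_one_pos` at `h = -2`, `x₂ = 0`,
as a polynomial inequality in `u = cosh x₁`. -/
lemma octic_lt {u : ℝ} (h1 : 1 ≤ u) (h2 : u ≤ 19/10) :
    (1 - u^2 + u + u^2 * (u^2 - 1) / 16) * ((u^2 - 1) * u^2) <
      (-(1/2) * u^4 + (5/2) * u^2 - (1/2) * u - 17/16)^2 := by
  have ha : 0 ≤ u - 1 := by linarith
  have hb : 0 ≤ 19/10 - u := by linarith
  have key (i j : ℕ) : 0 ≤ (u - 1)^i * (19/10 - u)^j := by positivity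
  linarith [key 0 8, key 1 7, key 2 6, key 3 5, key 4 4, key 5 3, key 6 2, key 7 1, key 8 0]

lemma V₁₁_eq (h x : ℝ) :
    V₁₁ h x = -(1/2) * cosh x^4 + (5/2) * cosh x^2 - (1/2) * cosh x - 17/16
      + (-2 - h) * (2 * cosh x^2 - 1) / 2 := by
  have h2 : cosh (2*x) = 2 * cosh x^2 - 1 := by
    rw [cosh_two_mul, sinh_sq]; ring
  have h4 : cosh (4*x) = 2 * cosh (2*x)^2 - 1 := by
    rw [show 4*x = 2*(2*x) by ring, cosh_two_mul, sinh_sq]; ring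
  rw [V₁₁, h4, h2]
  ring

/-- On energies `h ≤ -2`, the quantity `-2 V` is largest at `h = -2`, `x₂ = 0`. -/
lemma neg_two_mul_Vpot_le {h : ℝ} (hh : h ≤ -2) (x₁ x₂ : ℝ) :
    -2 * Vpot h x₁ x₂ ≤
      1 - cosh x₁^2 + cosh x₁ + cosh x₁^2 * (cosh x₁^2 - 1) / 16 := by
  have hu : 1 ≤ cosh x₁^2 := one_le_pow₀ (one_le_cosh x₁)
  have hw0 : 0 ≤ cos x₂^2 := sq_nonneg _
  have hw1 : cos x₂^2 ≤ 1 := cos_sq_le_one x₂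
  rw [Vpot, sinh_two_mul, sin_two_mul, mul_pow, mul_pow, mul_pow, mul_pow, sinh_sq, sin_sq]
  nlinarith [mul_nonneg (sub_nonneg.2 hh) (sub_nonneg.2 hu),
    mul_nonneg (sub_nonneg.2 hh) (sub_nonneg.2 hw1), mul_nonneg hw0 (sub_nonneg.2 hw1),
    sq_nonneg (1 - cos x₂^2)]

/-- Positivity of `c₋₁ = −r·sinh x₁·cosh x₁ + V₁₁` on the Hill region for all
energies `h ≤ −2`; consequently `c_t ≥ c₋₁ > 0` for all `t ∈ [−1,1]`. -/
theorem c_neg_one_pos (h x₁ x₂ : ℝ) (hh : h ≤ -2) (hx1 : 0 ≤ x₁)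
    (hch : cosh x₁ ≤ 19/10) (hx2 : 0 ≤ x₂) (hx2' : x₂ ≤ π/2)
    (hV : Vpot h x₁ x₂ ≤ 0) :
    let r : ℝ := Real.sqrt (-2 * Vpot h x₁ x₂)
    0 < -(r * sinh x₁ * cosh x₁) + V₁₁ h x₁ ∧
    ∀ t ∈ Set.Icc (-1 : ℝ) 1,
      -(r * sinh x₁ * cosh x₁) + V₁₁ h x₁ ≤
        r * t * sinh x₁ * cosh x₁ + V₁₁ h x₁ := by
  intro r
  have hs : 0 ≤ sinh x₁ := sinh_nonneg_iff.2 hx1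
  have hu : 1 ≤ cosh x₁ := one_le_cosh x₁
  have hr : 0 ≤ r := sqrt_nonneg _
  have hrsc : 0 ≤ r * sinh x₁ * cosh x₁ := by positivity
  refine ⟨?_, fun t ht => ?_⟩
  · have hr2 : r^2 = -2 * Vpot h x₁ x₂ := sq_sqrt (by linarith)
    have hB := quartic_pos hu hch
    have hlt : (r * sinh x₁ * cosh x₁)^2 <
        (-(1/2) * cosh x₁^4 + (5/2) * cosh x₁^2 - (1/2) * cosh x₁ - 17/16)^2 := by
      refine lt_of_le_of_lt ?_ (octic_lt hu hch)
      rw [mul_pow, mul_pow, hr2, mul_assoc, ← sinh_sq]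
      exact mul_le_mul_of_nonneg_right
        ((neg_two_mul_Vpot_le hh x₁ x₂).trans_eq (by rw [sinh_sq])) (by positivity)
    have hcmp := lt_of_pow_lt_pow_left₀ 2 hB.le hlt
    have hk : 0 ≤ (-2 - h) * (2 * cosh x₁^2 - 1) :=
      mul_nonneg (by linarith) (by nlinarith)
    rw [V₁₁_eq]
    linarith
  · nlinarith [mul_nonneg hrsc (neg_le_iff_add_nonneg.1 ht.1)]
end

section
/- Let h ≤ −2, θ ∈ ℝ, and let (x₁, x₂) ∈ ℝ² satisfy cosh x₁ ≤ 19/10, −π/2 ≤ x₂ ≤ π/2, and V_h(x₁, x₂) ≤ 0; in the case h = −2 assume moreover that (x₁, x₂) is neither (0, π/2) nor (0, −π/2). Set r := √(−2·V_h(x₁, x₂)), c := r·sin θ·sinh x₁·cosh x₁ + V₁₁(x₁), and d := −r·cos θ·sin x₂·cos x₂ + V₂₂(x₂). Then d·V₁(x₁)² + c·V₂(x₂)² + r²·c·d > 0. -/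
open Real

/-- First partial derivative `∂V/∂x₂`. -/
noncomputable def V₂ (h x₂ : ℝ) : ℝ :=
  -(1/32) * (8*h + cos (2*x₂)) * sin (2*x₂)

/-- Second partial derivative `∂²V/∂x₂²`. -/
noncomputable def V₂₂ (h x₂ : ℝ) : ℝ :=
  -(1/16) * (8*h * cos (2*x₂) + cos (4*x₂))

/-! ### Bivariate integer polynomials with a computable positivity test -/

/-- Integer polynomials in `w` and `z`: entry `i` of row `j` is the coefficient of
`w ^ i * z ^ j`. -/
abbrev BiPoly : Type := List (List ℤ)

namespace BiPoly

/-- The value of a polynomial in one variable. -/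
def evalRow (w : ℝ) : List ℤ → ℝ
  | [] => 0
  | c :: p => c + w * evalRow w p

/-- The value of a bivariate polynomial at `(w, z)`. -/
def eval (w z : ℝ) : BiPoly → ℝ
  | [] => 0
  | r :: p => evalRow w r + z * eval w z p

/-- Sum of two rows. -/
def addRow : List ℤ → List ℤ → List ℤ
  | [], q => q
  | a :: p, [] => a :: p
  | a :: p, b :: q => (a + b) :: addRow p q

/-- Product of two rows. -/
def mulRow : List ℤ → List ℤ → List ℤ
  | [], _ => []
  | a :: p, q => addRow (q.map (a * ·)) (0 :: mulRow p q)

/-- Sum of two polynomials. -/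
def add : BiPoly → BiPoly → BiPoly
  | [], q => q
  | a :: p, [] => a :: p
  | a :: p, b :: q => addRow a b :: add p q

/-- Product of two polynomials. -/
def mul : BiPoly → BiPoly → BiPoly
  | [], _ => []
  | a :: p, q => add (q.map (mulRow a)) ([] :: mul p q)

/-- The constant polynomial. -/
def const (c : ℤ) : BiPoly := [[c]]

instance : Add BiPoly := ⟨add⟩
instance : Mul BiPoly := ⟨mul⟩
instance : Sub BiPoly := ⟨fun p q => add p (mul (const (-1)) q)⟩
instance (n : ℕ) : OfNat BiPoly n := ⟨const n⟩
instance : Pow BiPoly ℕ := ⟨fun p n => n.rec (const 1) (fun _ q => mul p q)⟩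

variable (w z : ℝ)

lemma evalRow_add (p q : List ℤ) : evalRow w (addRow p q) = evalRow w p + evalRow w q := by
  induction p, q using addRow.induct with
  | case1 q => simp [addRow, evalRow]
  | case2 a p => simp [addRow, evalRow]
  | case3 a p b q ih => simp only [addRow, evalRow, ih]; push_cast; ring

lemma evalRow_smul (a : ℤ) (q : List ℤ) : evalRow w (q.map (a * ·)) = a * evalRow w q := by
  induction q with
  | nil => simp [evalRow]
  | cons b q ih => simp only [List.map_cons, evalRow, ih]; push_cast; ring

lemma evalRow_mul (p q : List ℤ) : evalRow w (mulRow p q) = evalRow w p * evalRow w q := by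
  induction p with
  | nil => simp [mulRow, evalRow]
  | cons a p ih =>
    simp only [mulRow, evalRow_add, evalRow_smul, evalRow, ih]; push_cast; ring

lemma eval_add' (p q : BiPoly) : eval w z (add p q) = eval w z p + eval w z q := by
  induction p, q using add.induct with
  | case1 q => simp [add, eval]
  | case2 a p => simp [add, eval]
  | case3 a p b q ih => simp only [add, eval, ih, evalRow_add]; ring

lemma eval_smul (a : List ℤ) (q : BiPoly) :
    eval w z (List.map (mulRow a) q : List (List ℤ)) = evalRow w a * eval w z q := by
  induction q with
  | nil => simp [eval]
  | cons b q ih => simp only [List.map_cons, eval, ih, evalRow_mul]; ring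

lemma eval_mul' (p q : BiPoly) : eval w z (mul p q) = eval w z p * eval w z q := by
  induction p with
  | nil => simp [mul, eval]
  | cons a p ih => simp only [mul, eval_add', eval_smul, eval, ih, evalRow]; ring

lemma eval_const (c : ℤ) : eval w z (const c) = c := by simp [const, eval, evalRow]

lemma eval_add (p q : BiPoly) : eval w z (p + q) = eval w z p + eval w z q := eval_add' w z p q

lemma eval_mul (p q : BiPoly) : eval w z (p * q) = eval w z p * eval w z q := eval_mul' w z p q

lemma eval_sub (p q : BiPoly) : eval w z (p - q) = eval w z p - eval w z q := by
  change eval w z (add p (mul (const (-1)) q)) = _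
  rw [eval_add', eval_mul', eval_const]; push_cast; ring

lemma eval_ofNat (n : ℕ) [n.AtLeastTwo] :
    eval w z (ofNat(n) : BiPoly) = (ofNat(n) : ℝ) := by
  change eval w z (const n) = _
  rw [eval_const, Int.cast_natCast]; rfl

lemma eval_one : eval w z (1 : BiPoly) = 1 := by
  change eval w z (const (1 : ℕ)) = _
  rw [eval_const]; simp

lemma eval_pow (p : BiPoly) (n : ℕ) : eval w z (p ^ n) = eval w z p ^ n := by
  induction n with
  | zero => change eval w z (const 1) = _; simp [eval_const]
  | succ n ih =>
    change eval w z (mul p (p ^ n)) = _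
    rw [eval_mul', ih]; ring

/-- Clears denominators after substituting `z = (a + b * X) / (q * (1 + X))`, which maps
`[0, ∞)` onto `[a / q, b / q)`. -/
def mobius (a b q : ℤ) : BiPoly → BiPoly
  | [] => []
  | r :: p => mul [r] ([[q], [q]] ^ p.length) + mul [[a], [b]] (mobius a b q p)

lemma mobius_eval (a b q : ℤ) (X : ℝ) (hX : z * (q * (1 + X)) = a + b * X) (p : BiPoly) :
    q * (1 + X) * eval w X (mobius a b q p) = (q * (1 + X)) ^ List.length p * eval w z p := by
  induction p with
  | nil => simp [mobius, eval]
  | cons r p ih =>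
    simp only [mobius, eval_add, eval_mul', eval_pow, List.length_cons]
    have h1 : eval w X [[q], [q]] = q * (1 + X) := by simp [eval, evalRow]; ring
    have h2 : eval w X [[a], [b]] = z * (q * (1 + X)) := by
      rw [hX]; simp [eval, evalRow]; ring
    have h3 : eval w X [r] = evalRow w r := by simp [eval]
    have h4 : eval w z (r :: p : List (List ℤ)) = evalRow w r + z * eval w z p := rfl
    rw [h1, h2, h3, h4]
    linear_combination z * (q * (1 + X)) * ih

lemma exists_mobius_param (a b q : ℤ) (ha : (a : ℝ) ≤ q * z) (hb : q * z < b) :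
    ∃ X : ℝ, 0 ≤ X ∧ z * (q * (1 + X)) = a + b * X := by
  have hb' : (0 : ℝ) < b - q * z := by linarith
  refine ⟨(q * z - a) / (b - q * z), div_nonneg (by linarith) hb'.le, ?_⟩
  have h := div_mul_cancel₀ (q * z - a) hb'.ne'
  linear_combination -h

lemma eval_nonneg_of_mobius {a b q : ℤ} (hq : 0 < q) (ha : (a : ℝ) ≤ q * z) (hb : q * z < b)
    (p : BiPoly) (h : ∀ X : ℝ, 0 ≤ X → 0 ≤ eval w X (mobius a b q p)) : 0 ≤ eval w z p := by
  obtain ⟨X, hX, e⟩ := exists_mobius_param z a b q ha hb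
  have hq' : (0 : ℝ) < q := by exact_mod_cast hq
  have hD : (0 : ℝ) < q * (1 + X) := by positivity
  have := mobius_eval w z a b q X e p
  have h0 : 0 ≤ (q * (1 + X)) ^ List.length p * eval w z p := by
    rw [← this]; exact mul_nonneg hD.le (h X hX)
  exact nonneg_of_mul_nonneg_right h0 (by positivity)

lemma eval_nonneg_of_rows (hz : 0 ≤ z) (p : BiPoly)
    (h : ∀ r ∈ (p : List (List ℤ)), 0 ≤ evalRow w r) : 0 ≤ eval w z p := by
  induction p with
  | nil => simp [eval]
  | cons r p ih =>
    have h1 := h r (by simp)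
    have h2 := ih fun r hr => h r (by simp [hr])
    simp only [eval]; positivity

lemma evalRow_nonneg (hw : 0 ≤ w) (p : List ℤ) (h : ∀ c ∈ p, 0 ≤ c) : 0 ≤ evalRow w p := by
  induction p with
  | nil => simp [evalRow]
  | cons c p ih =>
    have h1 : (0 : ℝ) ≤ c := by exact_mod_cast h c (by simp)
    have h2 := ih fun c hc => h c (by simp [hc])
    simp only [evalRow]; positivity

/-- View a polynomial in one variable as a polynomial in the second variable of `BiPoly`. -/
def ofRow (r : List ℤ) : BiPoly := r.map fun c => [c]

lemma eval_ofRow (r : List ℤ) : eval w z (ofRow r) = evalRow z r := by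
  induction r with
  | nil => rfl
  | cons c r ih =>
    change evalRow w [c] + z * eval w z (ofRow r) = _
    simp [ih, evalRow]

/-- A rectangle `[wa, wb) × [za, zb)` whose corners are in units of `1 / 32`. -/
structure Box where
  wa : ℤ
  wb : ℤ
  za : ℤ
  zb : ℤ

/-- Membership of a point in a box. -/
def Box.Mem (b : Box) (w z : ℝ) : Prop :=
  (b.wa ≤ 32 * w ∧ 32 * w < b.wb) ∧ (b.za ≤ 32 * z ∧ 32 * z < b.zb)

/-- Sufficient test for nonnegativity of a polynomial on a box. -/
def nonnegOn (b : Box) (p : BiPoly) : Bool :=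
  List.all (mobius b.za b.zb 32 p) fun r =>
    List.all (mobius b.wa b.wb 32 (ofRow r)) fun s => s.all fun c => decide (0 ≤ c)

variable {w z}

lemma eval_nonneg_of_nonnegOn {b : Box} {p : BiPoly} (h : nonnegOn b p = true)
    (hb : b.Mem w z) : 0 ≤ eval w z p := by
  obtain ⟨⟨h1, h2⟩, h3, h4⟩ := hb
  refine eval_nonneg_of_mobius w z (q := 32) (by norm_num) (by simpa using h3)
    (by simpa using h4) p fun X hX => eval_nonneg_of_rows w X hX _ fun r hr => ?_
  rw [← eval_ofRow 0]
  refine eval_nonneg_of_mobius 0 w (q := 32) (by norm_num) (by simpa using h1)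
    (by simpa using h2) _ fun X' hX' => eval_nonneg_of_rows 0 X' hX' _ fun s hs => ?_
  refine evalRow_nonneg 0 le_rfl _ fun c hc => ?_
  have := List.all_eq_true.1 h r hr
  have := List.all_eq_true.1 this s hs
  simpa using List.all_eq_true.1 this c hc

/-- Divisibility by `w`. -/
def wDvd (p : BiPoly) : Bool := List.all p fun r => decide (r.headD 0 = 0)

/-- The quotient by `w` of a polynomial divisible by `w`. -/
def divW (p : BiPoly) : BiPoly := List.map List.tail p

lemma eval_divW {p : BiPoly} (h : wDvd p = true) : eval w z p = w * eval w z (divW p) := by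
  induction p with
  | nil => simp [divW, eval]
  | cons r p ih =>
    have h' : decide (r.headD 0 = 0) = true ∧ wDvd p = true := by
      simpa [wDvd, List.all_cons] using h
    change evalRow w r + z * eval w z p = w * (evalRow w r.tail + z * eval w z (divW p))
    rw [ih h'.2]
    have hr : evalRow w r = w * evalRow w r.tail := by
      cases r with
      | nil => simp [evalRow]
      | cons c r =>
        have : c = 0 := by simpa using h'.1
        simp [evalRow, this]
    rw [hr]; ring

end BiPoly

/-! ### The determinant in the coordinates `w = cos² x₂`, `cosh x₁ = 1 + w z` -/

namespace UW

open BiPoly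

@[irreducible] def pw : BiPoly := [[0, 1]]
@[irreducible] def pv : BiPoly := [[], [0, 1]]
@[irreducible] def pu : BiPoly := 1 + pv
/-- `sinh² x₁` -/
@[irreducible] def ps : BiPoly := 2 * pv + pv ^ 2
/-- `sin² x₂` -/
@[irreducible] def py : BiPoly := 1 - pw
@[irreducible] def pS : BiPoly := pw * py
@[irreducible] def pt : BiPoly := ps + py
/-- `16 r²` at `h = -2` -/
@[irreducible] def pR : BiPoly := 17 * pw + 4 * pv ^ 3 + pv ^ 4 - pw ^ 2 - 14 * pv - 11 * pv ^ 2
@[irreducible] def pa : BiPoly := 7 + 11 * pv - 6 * pv ^ 2 - 2 * pv ^ 3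
@[irreducible] def pb : BiPoly := 17 - 2 * pw
/-- `16 V₁₁` at `h = -2` -/
@[irreducible] def pC : BiPoly := 7 + 40 * pv - 8 * pv ^ 2 - 32 * pv ^ 3 - 8 * pv ^ 4
/-- `16 V₂₂` at `h = -2` -/
@[irreducible] def pD : BiPoly := 40 * pw - 17 - 8 * pw ^ 2
@[irreducible] def pC' : BiPoly := 1 + 2 * ps
@[irreducible] def pD' : BiPoly := 2 * pw - 1
@[irreducible] def pA₀ : BiPoly := ps * pa ^ 2
@[irreducible] def pA₁ : BiPoly := 2 * (ps * (pa * pu))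
@[irreducible] def pA₂ : BiPoly := ps * pu ^ 2
@[irreducible] def pB₀ : BiPoly := pS * pb ^ 2
@[irreducible] def pB₁ : BiPoly := 2 * (pS * pb)

/-- Lower bound for `128 c` at `h = -2`, with weights for the inequality of arithmetic and
geometric means. -/
@[irreducible] def pc (m k : ℤ) : BiPoly := 8 * pC - const m * pR - const k * pA₂

/-- Lower bound for `128 d` at `h = -2`. -/
@[irreducible] def pd (n k : ℤ) : BiPoly := 8 * pD - const n * pR - const k * pS

/-- The coefficients of the lower bound of the determinant as a polynomial in `-8 h - 16`. -/
def g₀ (c d : BiPoly) : BiPoly := 8 * (pA₀ * d) + 8 * (pB₀ * c) + pR * (c * d)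

/-- See `g₀`. -/
def g₁ (c d : BiPoly) : BiPoly :=
  8 * (pA₁ * d) + 64 * (pA₀ * pD') + 8 * (pB₁ * c) + 64 * (pB₀ * pC')
    + 8 * (pR * (c * pD' + pC' * d)) - pt * (c * d)

/-- See `g₀`. -/
def g₂ (c d : BiPoly) : BiPoly :=
  8 * (pA₂ * d) + 64 * (pA₁ * pD') + 8 * (pS * c) + 64 * (pB₁ * pC')
    + 64 * (pR * (pC' * pD')) - 8 * (pt * (c * pD' + pC' * d))
    - 64 * (pR * ps)

/-- The test certifying positivity of the determinant on a box. -/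
def certified (b : Box) (c d : BiPoly) : Bool :=
  wDvd (g₀ c d) && wDvd (divW (g₀ c d)) && nonnegOn b (divW (divW (g₀ c d)) - 1)
    && nonnegOn b c && nonnegOn b (g₁ c d)
    && (nonnegOn b (g₂ c d) ||
      decide (0 < b.za) && nonnegOn b (pt * g₁ c d + pR * g₂ c d))

variable {w z : ℝ}

lemma eval_pw : eval w z pw = w := by simp [pw, eval, evalRow]

lemma eval_pv : eval w z pv = z * w := by simp [pv, eval, evalRow]

lemma det_monotone {A B R c d c₁ d₁ : ℝ} (hA : 0 ≤ A) (hB : 0 ≤ B) (hR : 0 ≤ R) (hc₁ : 0 ≤ c₁)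
    (hc : c₁ ≤ c) (hd : d₁ ≤ d) (h : 0 < A * d₁ + B * c₁ + R * (c₁ * d₁)) :
    0 < A * d + B * c + R * (c * d) := by
  have h₁ : 0 ≤ A + R * c := add_nonneg hA (mul_nonneg hR (hc₁.trans hc))
  have h₂ : 0 ≤ B + R * d₁ := by
    by_contra! hn
    have hd₁ : d₁ ≤ 0 := by
      by_contra! hp
      nlinarith [mul_nonneg hR hp.le]
    nlinarith [mul_nonneg hA (neg_nonneg.2 hd₁), mul_nonneg hc₁ (neg_nonneg.2 hn.le)]
  nlinarith [mul_le_mul_of_nonneg_left hd h₁, mul_le_mul_of_nonneg_right hc h₂]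

/-- Removes a square root by weighting its two factors. -/
lemma weighted_amgm {m m' X Y δ : ℝ} (hm : 0 ≤ m) (hm' : 0 ≤ m') (hmm : 256 ≤ m * m')
    (hX : 0 ≤ X) (hY : 0 ≤ Y) (h : δ ^ 2 ≤ 16 * (X * Y)) : -(m * X + m' * Y) ≤ 8 * δ := by
  refine (abs_le.1 (abs_le_of_sq_le_sq ?_ (by positivity))).1
  nlinarith [sq_nonneg (m * X - m' * Y), mul_nonneg (sub_nonneg.2 hmm) (mul_nonneg hX hY)]

lemma slope_nonneg {s y R E G₁ G₂ : ℝ} (hy : 0 ≤ y) (hE : 0 ≤ E)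
    (hR : 0 ≤ R - (s + y) * E) (h₁ : 0 ≤ G₁)
    (h₂ : 0 ≤ G₂ ∨ 0 < s ∧ 0 ≤ (s + y) * G₁ + R * G₂) : 0 ≤ G₁ + E * G₂ := by
  rcases le_or_gt 0 G₂ with h | h
  · positivity
  · obtain ⟨hs', h₂⟩ := h₂.resolve_left h.not_ge
    have : 0 ≤ (s + y) * (G₁ + E * G₂) := by nlinarith [mul_nonneg hR (neg_nonneg.2 h.le)]
    exact nonneg_of_mul_nonneg_right this (by positivity)

lemma det_pos_of_coeffs {s y R a u b C' D' c₁ d₁ E c d : ℝ} (hs : 0 ≤ s) (hy : 0 ≤ y)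
    (hy' : y ≤ 1) (hE : 0 ≤ E) (hR : 0 ≤ R - (s + y) * E) (hu : u ^ 2 = 1 + s)
    (hC' : C' = 1 + 2 * s) (hD' : D' = 1 - 2 * y) (hc₁ : 0 ≤ c₁)
    (hc : c₁ + 8 * C' * E ≤ 8 * c) (hd : d₁ + 8 * D' * E ≤ 8 * d)
    (h₀ : 0 < 8 * (s * a ^ 2 * d₁) + 8 * ((1 - y) * y * b ^ 2 * c₁) + R * (c₁ * d₁))
    (h₁ : 0 ≤ 8 * (2 * (s * (a * u)) * d₁) + 64 * (s * a ^ 2 * D')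
      + 8 * (2 * ((1 - y) * y * b) * c₁) + 64 * ((1 - y) * y * b ^ 2 * C')
      + 8 * (R * (c₁ * D' + C' * d₁)) - (s + y) * (c₁ * d₁)
      + E * (8 * (s * u ^ 2 * d₁) + 64 * (2 * (s * (a * u)) * D')
      + 8 * ((1 - y) * y * c₁) + 64 * (2 * ((1 - y) * y * b) * C')
      + 64 * (R * (C' * D')) - 8 * ((s + y) * (c₁ * D' + C' * d₁)) - 64 * (R * s))) :
    0 < s * (a + u * E) ^ 2 * d + (1 - y) * y * (b + E) ^ 2 * c
      + (R - (s + y) * E) * (c * d) := by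
  have hS : 0 ≤ (1 - y) * y := mul_nonneg (sub_nonneg.2 hy') hy
  have key := det_monotone (A := 8 * (s * (a + u * E) ^ 2)) (B := 8 * ((1 - y) * y * (b + E) ^ 2))
    (by positivity) (by positivity) hR (by rw [hC']; positivity) hc hd ?_
  · linarith
  · have h₂ := mul_nonneg hE h₁
    have h₃ : 0 ≤ E ^ 2 * (R - (s + y) * E) * s + E ^ 3 * (s + y) * (y + 2 * s * y) := by
      have := sub_nonneg.2 hy'
      positivity
    have e : s * u ^ 2 * D' + (1 - y) * y * C' - (s + y) * (C' * D')
        = (s + y) * (y - s + 2 * s * y) := by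
      rw [hu, hC', hD']; ring
    linear_combination h₀ + h₂ + 64 * h₃ - 64 * E ^ 3 * e

/-- The determinant is positive at `(w, z)` for every energy and every angle. The energy is
`h = -2 - E / 8`, and the matrix entries are multiplied by `16`. -/
def DetPos (w z : ℝ) : Prop :=
  ∀ E c d : ℝ, 0 ≤ E → 0 ≤ eval w z ps → 0 ≤ eval w z pR - eval w z pt * E →
    (c - (eval w z pC + eval w z pC' * E)) ^ 2 ≤ 16 * (eval w z pR * eval w z pA₂) →
    (d - (eval w z pD + eval w z pD' * E)) ^ 2 ≤ 16 * (eval w z pR * eval w z pS) →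
    0 < eval w z ps * (eval w z pa + eval w z pu * E) ^ 2 * d
      + eval w z pS * (eval w z pb + E) ^ 2 * c
      + (eval w z pR - eval w z pt * E) * (c * d)

lemma detPos_of_certified {b : Box} {m m' n n' : ℤ} (hm : 0 ≤ m) (hm' : 0 ≤ m') (hn : 0 ≤ n)
    (hn' : 0 ≤ n') (hmm : 256 ≤ m * m') (hnn : 256 ≤ n * n')
    (hcert : certified b (pc m m') (pd n n') = true) (hb : b.Mem w z) (hw : 0 < w) (hw' : w ≤ 1) :
    DetPos w z := by
  intro E c d hE hs hR hc hd
  simp only [certified, Bool.and_eq_true, Bool.or_eq_true, decide_eq_true_eq] at hcert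
  obtain ⟨⟨⟨⟨⟨h₁, h₂⟩, h₃⟩, h₄⟩, h₅⟩, h₆⟩ := hcert
  have k₀ : 0 < eval w z (g₀ (pc m m') (pd n n')) := by
    have := eval_nonneg_of_nonnegOn h₃ hb
    rw [eval_sub, eval_one] at this
    rw [eval_divW h₁, eval_divW h₂]
    exact mul_pos hw (mul_pos hw (by linarith))
  have kc := eval_nonneg_of_nonnegOn h₄ hb
  have k₁ := eval_nonneg_of_nonnegOn h₅ hb
  have k₂ := h₆.imp (eval_nonneg_of_nonnegOn · hb)
    (fun h => And.intro h.1 (eval_nonneg_of_nonnegOn h.2 hb))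
  have es : eval w z ps = 2 * (z * w) + (z * w) ^ 2 := by
    simp only [ps, eval_add, eval_mul, eval_pow, eval_ofNat, eval_pv]
  have eu : eval w z pu = 1 + z * w := by simp only [pu, eval_add, eval_one, eval_pv]
  have ey : eval w z py = 1 - w := by simp only [py, eval_sub, eval_one, eval_pw]
  have eD' : eval w z pD' = 2 * w - 1 := by
    simp only [pD', eval_sub, eval_mul, eval_ofNat, eval_one, eval_pw]
  have eC' : eval w z pC' = 1 + 2 * eval w z ps := by
    simp only [pC', eval_add, eval_mul, eval_ofNat, eval_one]
  have ec : eval w z (pc m m') = 8 * eval w z pC - m * eval w z pR - m' * eval w z pA₂ := by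
    simp only [pc, eval_sub, eval_mul, eval_const, eval_ofNat]
  have ed : eval w z (pd n n') = 8 * eval w z pD - n * eval w z pR - n' * eval w z pS := by
    simp only [pd, eval_sub, eval_mul, eval_const, eval_ofNat]
  have et : eval w z pt = eval w z ps + eval w z py := by simp only [pt, eval_add]
  have eS : eval w z pS = (1 - eval w z py) * eval w z py := by
    rw [ey]; simp only [pS, eval_mul, eval_pw, ey]; ring
  have eA₂ : eval w z pA₂ = eval w z ps * eval w z pu ^ 2 := by
    simp only [pA₂, eval_mul, eval_pow]
  have hy : 0 ≤ eval w z py := by rw [ey]; linarith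
  have hy' : eval w z py ≤ 1 := by rw [ey]; linarith
  have hz : 0 < b.za → 0 < eval w z ps := fun h => by
    have h' : (0 : ℝ) < b.za := by exact_mod_cast h
    have : 0 < z := by linarith [hb.2.1]
    rw [es]; positivity
  have hu : eval w z pu ^ 2 = 1 + eval w z ps := by rw [eu, es]; ring
  have hD' : eval w z pD' = 1 - 2 * eval w z py := by rw [eD', ey]; ring
  simp only [g₀, g₁, g₂, pA₀, pA₁, pB₀, pB₁, eval_add, eval_sub, eval_mul, eval_pow, eval_ofNat,
    et, eA₂, eS] at k₀ k₁ k₂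
  rw [et] at hR ⊢
  rw [eA₂] at hc ec
  rw [eS] at hd ed ⊢
  have hR₀ : 0 ≤ eval w z pR := by linarith only [hR, mul_nonneg (add_nonneg hs hy) hE]
  have hc₈ := weighted_amgm (by exact_mod_cast hm) (by exact_mod_cast hm')
    (by exact_mod_cast hmm : (256 : ℝ) ≤ m * m') hR₀
    (mul_nonneg hs (sq_nonneg _)) hc
  have hd₈ := weighted_amgm (by exact_mod_cast hn) (by exact_mod_cast hn')
    (by exact_mod_cast hnn : (256 : ℝ) ≤ n * n') hR₀
    (mul_nonneg (sub_nonneg.2 hy') hy) hd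
  exact det_pos_of_coeffs hs hy hy' hE hR hu eC' hD' kc (by linarith only [ec, hc₈])
    (by linarith only [ed, hd₈]) k₀
    (slope_nonneg hy hE hR k₁ (k₂.imp id fun h => ⟨hz h.1, h.2⟩))

/-- `certified` together with its side conditions on the weights. -/
def certifies (b : Box) (m m' n n' : ℤ) : Bool :=
  decide (0 ≤ m ∧ 0 ≤ m' ∧ 0 ≤ n ∧ 0 ≤ n' ∧ 256 ≤ m * m' ∧ 256 ≤ n * n')
    && certified b (pc m m') (pd n n')

lemma detPos_of_certifies {b : Box} {m m' n n' : ℤ} (h : certifies b m m' n n' = true)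
    (hb : b.Mem w z) (hw : 0 < w) (hw' : w ≤ 1) : DetPos w z := by
  rw [certifies, Bool.and_eq_true, decide_eq_true_eq] at h
  obtain ⟨⟨hm, hm', hn, hn', hmm, hnn⟩, h⟩ := h
  exact detPos_of_certified hm hm' hn hn' hmm hnn h hb hw hw'

lemma certifies_0_0 : certifies ⟨0, 16, 0, 20⟩ 4 64 4 64 = true := by
  decide +kernel

lemma certifies_0_20 : certifies ⟨0, 16, 20, 40⟩ 16 16 6 43 = true := by
  decide +kernel

lemma certifies_16_0 : certifies ⟨16, 33, 0, 5⟩ 2 128 2 128 = true := by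
  decide +kernel

lemma certifies_16_5 : certifies ⟨16, 33, 5, 10⟩ 4 64 2 128 = true := by
  decide +kernel

lemma certifies_16_10 : certifies ⟨16, 33, 10, 15⟩ 6 43 3 86 = true := by
  decide +kernel

lemma certifies_16_15 : certifies ⟨16, 33, 15, 20⟩ 12 22 3 86 = true := by
  decide +kernel

lemma certifies_16_20 : certifies ⟨16, 33, 20, 25⟩ 20 13 4 64 = true := by
  decide +kernel

lemma certifies_16_25 : certifies ⟨16, 33, 25, 30⟩ 64 4 16 16 = true := by
  decide +kernel

lemma nonnegOn_excluded : nonnegOn ⟨16, 33, 30, 40⟩ (0 - 8 * divW pR - 1) = true := by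
  decide +kernel

lemma wDvd_pR : wDvd pR = true := by decide +kernel

lemma detPos (hw : 0 < w) (hw' : w ≤ 1) (hz : 0 ≤ z) (hz' : z < 5 / 4)
    (hR : 0 ≤ eval w z pR) : DetPos w z := by
  rcases lt_or_ge (32 * w) 16 with hw₁ | hw₁
  · rcases lt_or_ge (32 * z) 20 with h | h
    · exact detPos_of_certifies certifies_0_0 (by simp only [Box.Mem]; norm_num; grind) hw hw'
    · exact detPos_of_certifies certifies_0_20 (by simp only [Box.Mem]; norm_num; grind) hw hw'
  rcases lt_or_ge (32 * z) 5 with h5 | h5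
  · exact detPos_of_certifies certifies_16_0 (by simp only [Box.Mem]; norm_num; grind) hw hw'
  rcases lt_or_ge (32 * z) 10 with h10 | h10
  · exact detPos_of_certifies certifies_16_5 (by simp only [Box.Mem]; norm_num; grind) hw hw'
  rcases lt_or_ge (32 * z) 15 with h15 | h15
  · exact detPos_of_certifies certifies_16_10 (by simp only [Box.Mem]; norm_num; grind) hw hw'
  rcases lt_or_ge (32 * z) 20 with h20 | h20
  · exact detPos_of_certifies certifies_16_15 (by simp only [Box.Mem]; norm_num; grind) hw hw'
  rcases lt_or_ge (32 * z) 25 with h25 | h25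
  · exact detPos_of_certifies certifies_16_20 (by simp only [Box.Mem]; norm_num; grind) hw hw'
  rcases lt_or_ge (32 * z) 30 with h30 | h30
  · exact detPos_of_certifies certifies_16_25 (by simp only [Box.Mem]; norm_num; grind) hw hw'
  have h := eval_nonneg_of_nonnegOn (w := w) (z := z) nonnegOn_excluded
    (by simp only [Box.Mem]; norm_num; grind)
  rw [eval_divW wDvd_pR] at hR
  have e₀ : eval w z (0 : BiPoly) = 0 := by
    change eval w z (const (0 : ℕ)) = _
    simp [eval_const]
  rw [eval_sub, eval_sub, eval_mul, e₀, eval_one, eval_ofNat] at h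
  nlinarith [nonneg_of_mul_nonneg_right hR hw]

section

variable (h x₁ x₂ : ℝ)

lemma Vpot_eq : 16 * (-2 * Vpot h x₁ x₂) =
    17 * cos x₂ ^ 2 - cos x₂ ^ 4 - 14 * (cosh x₁ - 1) - 11 * (cosh x₁ - 1) ^ 2
      + 4 * (cosh x₁ - 1) ^ 3 + (cosh x₁ - 1) ^ 4
      - (cosh x₁ ^ 2 - cos x₂ ^ 2) * (-8 * h - 16) := by
  simp only [Vpot, sinh_two_mul, sin_two_mul, mul_pow, sinh_sq, sin_sq]
  ring

lemma V₁_eq : 16 * V₁ h x₁ =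
    sinh x₁ * (17 * cosh x₁ - 2 * cosh x₁ ^ 3 - 8 + cosh x₁ * (-8 * h - 16)) := by
  rw [V₁, cosh_three_mul]
  ring

lemma V₂_eq : 16 * V₂ h x₂ =
    sin x₂ * cos x₂ * (17 - 2 * cos x₂ ^ 2 + (-8 * h - 16)) := by
  rw [V₂, sin_two_mul, cos_two_mul]
  ring

lemma V₁₁_eq : 16 * V₁₁ h x₁ =
    -8 * cosh x₁ ^ 4 + 40 * cosh x₁ ^ 2 - 8 * cosh x₁ - 17
      + (2 * cosh x₁ ^ 2 - 1) * (-8 * h - 16) := by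
  rw [V₁₁, show 4 * x₁ = 2 * (2 * x₁) by ring, cosh_two_mul (2 * x₁), sinh_sq, cosh_two_mul,
    sinh_sq]
  ring

lemma V₂₂_eq : 16 * V₂₂ h x₂ =
    -17 + 40 * cos x₂ ^ 2 - 8 * cos x₂ ^ 4 + (2 * cos x₂ ^ 2 - 1) * (-8 * h - 16) := by
  rw [V₂₂, show 4 * x₂ = 2 * (2 * x₂) by ring, cos_two_mul (2 * x₂), cos_two_mul]
  ring

end

lemma sq_angle_le {r k t R : ℝ} (hr : 16 * r ^ 2 ≤ R) (ht : t ^ 2 ≤ 1) :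
    (16 * (r * t * k)) ^ 2 ≤ 16 * (R * k ^ 2) := by
  have h₁ : r ^ 2 * t ^ 2 ≤ r ^ 2 := mul_le_of_le_one_right (sq_nonneg r) ht
  nlinarith [mul_le_mul_of_nonneg_right h₁ (sq_nonneg k),
    mul_le_mul_of_nonneg_right hr (sq_nonneg k)]

lemma eq_zero_of_cos_eq_zero {v E : ℝ} (hv : 0 ≤ v) (hv' : v ≤ 9 / 10) (hE : 0 ≤ E)
    (hR : 0 ≤ -14 * v - 11 * v ^ 2 + 4 * v ^ 3 + v ^ 4 - (1 + v) ^ 2 * E) :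
    v = 0 ∧ E = 0 := by
  have h₁ : 0 ≤ v ^ 2 * (11 - 4 * v - v ^ 2) := mul_nonneg (sq_nonneg v) (by nlinarith)
  have h₂ : E ≤ (1 + v) ^ 2 * E := le_mul_of_one_le_left hE (by nlinarith)
  constructor <;> nlinarith

lemma lt_of_energy_nonneg {w z : ℝ} (hw : 0 < w) (hz : 0 ≤ z) (hv : z * w ≤ 9 / 10)
    (hR : 0 ≤ 17 * w - w ^ 2 - 14 * (z * w) - 11 * (z * w) ^ 2 + 4 * (z * w) ^ 3 + (z * w) ^ 4) :
    z < 5 / 4 := by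
  have hv₀ : 0 ≤ z * w := mul_nonneg hz hw.le
  have h₁ : 0 ≤ (z * w) ^ 2 * (11 - 4 * (z * w) - (z * w) ^ 2) :=
    mul_nonneg (sq_nonneg _) (by nlinarith)
  have h₂ : 14 * z * w ≤ 17 * w := by nlinarith
  linarith [le_of_mul_le_mul_right h₂ hw]

/-- The determinant in algebraic coordinates: `q = sinh x₁`, `u = cosh x₁`, `p = sin x₂`,
`g = cos x₂`, with `j` and `k` the sine and cosine of the angle. -/
lemma det_pos_algebraic {u q g p r j k E : ℝ} (hq : q ^ 2 = u ^ 2 - 1) (hp : p ^ 2 = 1 - g ^ 2)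
    (hu : 1 ≤ u) (hu' : u ≤ 19 / 10) (hg : g ≠ 0) (hE : 0 ≤ E) (hj : j ^ 2 ≤ 1) (hk : k ^ 2 ≤ 1)
    (hr : 16 * r ^ 2 = 17 * g ^ 2 - g ^ 4 - 14 * (u - 1) - 11 * (u - 1) ^ 2 + 4 * (u - 1) ^ 3
      + (u - 1) ^ 4 - (u ^ 2 - g ^ 2) * E) :
    0 < (q * (17 * u - 2 * u ^ 3 - 8 + u * E)) ^ 2
        * (-8 * g ^ 4 + 40 * g ^ 2 - 17 + (2 * g ^ 2 - 1) * E - 16 * (r * k * (p * g)))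
      + (p * g * (17 - 2 * g ^ 2 + E)) ^ 2
        * (-8 * u ^ 4 + 40 * u ^ 2 - 8 * u - 17 + (2 * u ^ 2 - 1) * E + 16 * (r * j * (q * u)))
      + 16 * r ^ 2
        * ((-8 * u ^ 4 + 40 * u ^ 2 - 8 * u - 17 + (2 * u ^ 2 - 1) * E + 16 * (r * j * (q * u)))
          * (-8 * g ^ 4 + 40 * g ^ 2 - 17 + (2 * g ^ 2 - 1) * E - 16 * (r * k * (p * g)))) := by
  have hw : 0 < g ^ 2 := by positivity
  have hw' : g ^ 2 ≤ 1 := by nlinarith [sq_nonneg p]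
  set w := g ^ 2 with hwdef
  set z := (u - 1) / w with hzdef
  have hz : 0 ≤ z := div_nonneg (by linarith) hw.le
  have hzw : z * w = u - 1 := div_mul_cancel₀ _ hw.ne'
  have ev : eval w z pv = u - 1 := by rw [eval_pv, hzw]
  have eu : eval w z pu = u := by simp only [pu, eval_add, eval_one, ev]; ring
  have es : eval w z ps = q ^ 2 := by
    simp only [ps, eval_add, eval_mul, eval_pow, eval_ofNat, ev, hq]; ring
  have ey : eval w z py = p ^ 2 := by simp only [py, eval_sub, eval_one, eval_pw, hp]
  have eS : eval w z pS = (p * g) ^ 2 := by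
    simp only [pS, eval_mul, eval_pw, ey]; ring
  have et : eval w z pt = u ^ 2 - w := by simp only [pt, eval_add, es, ey, hq, hp]; ring
  have eA₂ : eval w z pA₂ = (q * u) ^ 2 := by
    simp only [pA₂, eval_mul, eval_pow, es, eu]; ring
  have eR : eval w z pR = 17 * w - w ^ 2 - 14 * (u - 1) - 11 * (u - 1) ^ 2 + 4 * (u - 1) ^ 3
      + (u - 1) ^ 4 := by
    simp only [pR, eval_add, eval_sub, eval_mul, eval_pow, eval_ofNat, eval_pw, ev]; ring
  have ea : eval w z pa = 17 * u - 2 * u ^ 3 - 8 := by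
    simp only [pa, eval_add, eval_sub, eval_mul, eval_pow, eval_ofNat, ev]; ring
  have eb : eval w z pb = 17 - 2 * w := by
    simp only [pb, eval_sub, eval_mul, eval_ofNat, eval_pw]
  have eC : eval w z pC = -8 * u ^ 4 + 40 * u ^ 2 - 8 * u - 17 := by
    simp only [pC, eval_add, eval_sub, eval_mul, eval_pow, eval_ofNat, ev]; ring
  have eD : eval w z pD = -8 * w ^ 2 + 40 * w - 17 := by
    simp only [pD, eval_sub, eval_mul, eval_pow, eval_ofNat, eval_pw]; ring
  have eC' : eval w z pC' = 2 * u ^ 2 - 1 := by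
    simp only [pC', eval_add, eval_mul, eval_ofNat, eval_one, es, hq]; ring
  have eD' : eval w z pD' = 2 * w - 1 := by
    simp only [pD', eval_sub, eval_mul, eval_ofNat, eval_one, eval_pw]
  have hg4 : g ^ 4 = w ^ 2 := by rw [hwdef]; ring
  rw [hg4] at hr ⊢
  have hrR : 16 * r ^ 2 = eval w z pR - eval w z pt * E := by rw [eR, et]; exact hr
  have htE : 0 ≤ eval w z pt * E := by
    rw [et]; exact mul_nonneg (by nlinarith) hE
  have hrR' : 16 * r ^ 2 ≤ eval w z pR := by linarith
  have hR : 0 ≤ eval w z pR := le_trans (by positivity) hrR'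
  have hz' : z < 5 / 4 := by
    refine lt_of_energy_nonneg hw hz (by linarith) ?_
    rw [hzw, ← eR]; exact hR
  have key := detPos hw hw' hz hz' hR E
    (-8 * u ^ 4 + 40 * u ^ 2 - 8 * u - 17 + (2 * u ^ 2 - 1) * E + 16 * (r * j * (q * u)))
    (-8 * w ^ 2 + 40 * w - 17 + (2 * w - 1) * E - 16 * (r * k * (p * g))) hE
    (by rw [es]; positivity) (by rw [← hrR]; positivity)
    (by rw [eC, eC', eA₂, add_sub_cancel_left]; exact sq_angle_le hrR' hj)
    (by
      rw [eD, eD', eS, sub_sub_cancel_left, neg_sq]; exact sq_angle_le hrR' hk)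
  rw [← hrR, es, eS, ea, eb, eu] at key
  rw [mul_pow q, mul_pow (p * g)]
  exact key

end UW

/-- Strict convexity criterion for the regularized restricted three-body problem at
mass ratio `1/2`: `det U_W = d·V₁² + c·V₂² + r²·c·d > 0` at every point of the Hill
region for every energy `h ≤ −2`, except the saddle-center singularities
`(0, ±π/2)` at the critical energy `h = −2`. -/
theorem det_UW_pos (h θ x₁ x₂ : ℝ) (hh : h ≤ -2)
    (hch : cosh x₁ ≤ 19/10) (hx2 : -(π/2) ≤ x₂) (hx2' : x₂ ≤ π/2)
    (hV : Vpot h x₁ x₂ ≤ 0)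
    (hsing : h = -2 → (x₁, x₂) ≠ (0, π/2) ∧ (x₁, x₂) ≠ (0, -(π/2))) :
    let r : ℝ := Real.sqrt (-2 * Vpot h x₁ x₂)
    let c : ℝ := r * Real.sin θ * sinh x₁ * cosh x₁ + V₁₁ h x₁
    let d : ℝ := -(r * Real.cos θ * sin x₂ * cos x₂) + V₂₂ h x₂
    0 < d * (V₁ h x₁)^2 + c * (V₂ h x₂)^2 + r^2 * c * d := by
  intro r c d
  have hu : 1 ≤ cosh x₁ := one_le_cosh x₁
  have hr : 16 * r ^ 2 = 16 * (-2 * Vpot h x₁ x₂) := by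
    rw [Real.sq_sqrt (by linarith)]
  have hr' := hr.trans (UW.Vpot_eq h x₁ x₂)
  have hg : cos x₂ ≠ 0 := by
    intro h₀
    obtain ⟨hv, hE⟩ := UW.eq_zero_of_cos_eq_zero (v := cosh x₁ - 1) (E := -8 * h - 16)
      (by linarith) (by linarith) (by linarith) (by
        rw [h₀] at hr'
        have := sq_nonneg r
        linarith)
    have hx₁ : x₁ = 0 := by
      by_contra hne
      linarith [one_lt_cosh.2 hne]
    obtain ⟨h₁, h₂⟩ := hsing (by linarith)
    rw [hx₁] at h₁ h₂
    have h₁' : x₂ < π / 2 := lt_of_le_of_ne hx2' fun e => h₁ (by rw [e])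
    have h₂' : -(π / 2) < x₂ := lt_of_le_of_ne hx2 fun e => h₂ (by rw [← e])
    exact (cos_pos_of_mem_Ioo ⟨h₂', h₁'⟩).ne' h₀
  have key := UW.det_pos_algebraic (E := -8 * h - 16) (sinh_sq x₁) (sin_sq x₂) hu hch hg
    (by linarith) (sin_sq_le_one θ) (cos_sq_le_one θ) hr'
  rw [← UW.V₁_eq, ← UW.V₂_eq] at key
  have hc : 16 * c = -8 * cosh x₁ ^ 4 + 40 * cosh x₁ ^ 2 - 8 * cosh x₁ - 17
      + (2 * cosh x₁ ^ 2 - 1) * (-8 * h - 16) + 16 * (r * sin θ * (sinh x₁ * cosh x₁)) := by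
    rw [← UW.V₁₁_eq]; ring
  have hd : 16 * d = -8 * cos x₂ ^ 4 + 40 * cos x₂ ^ 2 - 17
      + (2 * cos x₂ ^ 2 - 1) * (-8 * h - 16) - 16 * (r * cos θ * (sin x₂ * cos x₂)) := by
    have := UW.V₂₂_eq h x₂
    linear_combination this
  rw [← hc, ← hd] at key
  linarith
end

section
/- Let (x₁, x₂) ∈ ℝ² satisfy 0 ≤ x₁, cosh x₁ ≤ 19/10, 0 ≤ x₂ ≤ π/2, V_{−2}(x₁, x₂) ≤ 0, and (x₁, x₂) ≠ (0, π/2). Set r := √(−2·V_{−2}(x₁, x₂)) and r̃ := √(−2·V_{−2}(0, x₂)) (note that V_{−2}(0, x₂) ≤ V_{−2}(x₁, x₂) ≤ 0, so both square roots are of nonnegative numbers). Let c₋₁ := −r·sinh x₁·cosh x₁ + V₁₁(x₁) (which is positive at all such points) and D(x₂) := −r̃·sin x₂·cos x₂ + V₂₂(x₂), where the derivatives are taken with h = −2. Then I₀ := V₂(x₂)² + D(x₂)·( V₁(x₁)²/c₋₁ + r² ) > 0. -/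
open Real

/-- Homogenized `16 V₁ / sinh` in `p = cosh x₁ - 1`. -/
noncomputable def slopeForm (p o : ℝ) : ℝ := 7*o^3 + 11*p*o^2 - 6*p^2*o - 2*p^3

/-- Homogenized `sinh² x₁` in `p = cosh x₁ - 1`. -/
noncomputable def sinhSqForm (p o : ℝ) : ℝ := 2*p*o + p^2

/-- Homogenized `32 (V₋₂(x₁, x₂) - V₋₂(0, x₂))` in `p = cosh x₁ - 1`. -/
noncomputable def barrierForm (p o : ℝ) : ℝ := 14*p*o^3 + 11*p^2*o^2 - 4*p^3*o - p^4

/-- Homogenized `16 V₁₁` in `p = cosh x₁ - 1`. -/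
noncomputable def hessForm (p o : ℝ) : ℝ := 7*o^4 + 40*p*o^3 - 8*p^2*o^2 - 32*p^3*o - 8*p^4

/-- Homogenized `16 r²` in `p = cosh x₁ - 1` and `t = cos² x₂`. -/
noncomputable def hillForm (p t o : ℝ) : ℝ := 17*t*o^3 - t^2*o^2 - barrierForm p o

/-- Homogenized lower bound for `16 c₋₁`, obtained from
`16 r sinh x₁ ≤ m (16 r²) + n sinh² x₁` with `m n = 4`. -/
noncomputable def cForm (m n p t o : ℝ) : ℝ :=
  hessForm p o * o - (o + p) * (m * hillForm p t o + n * sinhSqForm p o * o^2)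

/-- Homogenized lower bound for `16 D`, obtained from `√((17 - t) (1 - t)) ≤ α - β t`. -/
noncomputable def dForm (α β t o : ℝ) : ℝ := -17*o^2 + 40*t*o - 8*t^2 - 4*t*(α*o - β*t)

/-- Homogenized `16³ c₋₁ I₀` with `16 c₋₁` and `16 D` replaced by `cForm` and `dForm`. -/
noncomputable def IForm (m n α β p t o : ℝ) : ℝ :=
  (17*o - 2*t)^2 * t * (o - t) * cForm m n p t o * o^2
    + dForm α β t o *
      (slopeForm p o^2 * sinhSqForm p o * o + hillForm p t o * cForm m n p t o)

/-! Positivity of the forms on triangles and boxes, where all Bernstein coefficients are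
nonnegative. -/

section Certificates

variable {q s u v y z : ℝ}

theorem hessForm_pos_aux (hu : 0 ≤ u) (hv : 0 ≤ v) :
    (u + v)^4 ≤ hessForm (41/50 * v) (u + v) := by
  rw [← sub_nonneg]
  unfold hessForm
  ring_nf
  positivity

theorem hessForm_sq_aux (hu : 0 ≤ u) (hv : 0 ≤ v) :
    (u + v)^8 ≤ hessForm (41/50 * v) (u + v)^2
      - 16 * (16 * (u + v)^4 - barrierForm (41/50 * v) (u + v))
        * (u + v + 41/50 * v)^2 * sinhSqForm (41/50 * v) (u + v) := by
  rw [← sub_nonneg]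
  unfold hessForm barrierForm sinhSqForm
  ring_nf
  positivity

theorem cForm_small_low (hu : 0 ≤ u) (hv : 0 ≤ v) (hz : 0 ≤ z) :
    (z + 5*(u + v))^5 ≤
      cForm (11/20) (80/11) (7/20*v) (u + v) (z + 5*(u + v)) := by
  rw [← sub_nonneg]
  unfold cForm hillForm hessForm barrierForm sinhSqForm
  ring_nf
  positivity

set_option maxRecDepth 10000 in
theorem IForm_small_low (hu : 0 ≤ u) (hv : 0 ≤ v) (hz : 0 ≤ z) :
    (u + v)^2 * (z + 5*(u + v))^9 ≤
      IForm (11/20) (80/11) (1031/250) (109/50) (7/20*v) (u + v) (z + 5*(u + v)) := by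
  rw [← sub_nonneg]
  unfold IForm dForm cForm hillForm hessForm barrierForm sinhSqForm slopeForm
  ring_nf
  positivity

theorem cForm_small_high (hu : 0 ≤ u) (hv : 0 ≤ v) (hz : 0 ≤ z) :
    (z + 5*(u + v))^5 ≤
      cForm (11/20) (80/11) (7/20*u + 5/4*v) (u + v) (z + 5*(u + v)) := by
  rw [← sub_nonneg]
  unfold cForm hillForm hessForm barrierForm sinhSqForm
  ring_nf
  positivity

set_option maxRecDepth 10000 in
theorem IForm_small_high (hu : 0 ≤ u) (hv : 0 ≤ v) (hz : 0 ≤ z) :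
    (u + v)^2 * (z + 5*(u + v))^9 ≤
      IForm (11/20) (80/11) (1031/250) (109/50) (7/20*u + 5/4*v) (u + v) (z + 5*(u + v)) := by
  rw [← sub_nonneg]
  unfold IForm dForm cForm hillForm hessForm barrierForm sinhSqForm slopeForm
  ring_nf
  positivity

theorem cForm_mid (hq : 0 ≤ q) (hs : 0 ≤ s) (hy : 0 ≤ y) (hz : 0 ≤ z) :
    ((y + z) * (q + s))^5 / 100 ≤
      cForm (13/20) (80/13) (q * (2/25*(y + z) + 19/25*(1/5*y + 3/5*z)))
        ((1/5*y + 3/5*z) * (q + s)) ((y + z) * (q + s)) := by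
  rw [← sub_nonneg]
  unfold cForm hillForm hessForm barrierForm sinhSqForm
  ring_nf
  positivity

set_option maxRecDepth 10000 in
theorem IForm_mid (hq : 0 ≤ q) (hs : 0 ≤ s) (hy : 0 ≤ y) (hz : 0 ≤ z) :
    ((y + z) * (q + s))^11 ≤
      IForm (13/20) (80/13) (1031/250) (109/50) (q * (2/25*(y + z) + 19/25*(1/5*y + 3/5*z)))
        ((1/5*y + 3/5*z) * (q + s)) ((y + z) * (q + s)) := by
  rw [← sub_nonneg]
  unfold IForm dForm cForm hillForm hessForm barrierForm sinhSqForm slopeForm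
  ring_nf
  positivity

theorem cForm_large (hq : 0 ≤ q) (hs : 0 ≤ s) (hy : 0 ≤ y) (hz : 0 ≤ z) :
    ((y + z) * (q + s))^5 / 100 ≤
      cForm (3/5) (20/3) (q * (2/25*(y + z) + 19/25*(3/5*y + 7/10*z)))
        ((3/5*y + 7/10*z) * (q + s)) ((y + z) * (q + s)) := by
  rw [← sub_nonneg]
  unfold cForm hillForm hessForm barrierForm sinhSqForm
  ring_nf
  positivity

set_option maxRecDepth 10000 in
theorem IForm_large (hq : 0 ≤ q) (hs : 0 ≤ s) (hy : 0 ≤ y) (hz : 0 ≤ z) :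
    ((y + z) * (q + s))^11 ≤
      IForm (3/5) (20/3) (453/100) (82/25) (q * (2/25*(y + z) + 19/25*(3/5*y + 7/10*z)))
        ((3/5*y + 7/10*z) * (q + s)) ((y + z) * (q + s)) := by
  rw [← sub_nonneg]
  unfold IForm dForm cForm hillForm hessForm barrierForm sinhSqForm slopeForm
  ring_nf
  positivity

end Certificates

/-- Positivity of `cForm` and `IForm` implies `I₀ > 0`. -/
theorem I_pos_of_forms {m n α β p t r S c D : ℝ} (hm : 0 ≤ m) (hn : 0 ≤ n) (hmn : m * n = 4)
    (hp : 0 ≤ p) (ht0 : 0 < t) (ht1 : t < 1) (hS : S^2 = sinhSqForm p 1)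
    (hr : 16 * r^2 = hillForm p t 1) (hc : 16 * c = hessForm p 1 - 16 * (r * S) * (1 + p))
    (hD : dForm α β t 1 ≤ 16 * D) (hcF : 0 < cForm m n p t 1) (hI : 0 < IForm m n α β p t 1) :
    0 < (17 - 2*t)^2 * t * (1 - t) / 256 + D * ((slopeForm p 1 * S / 16)^2 / c + r^2) := by
  have hV2 : 0 < (17 - 2*t)^2 * t * (1 - t) / 256 := by
    have h1 : 0 < 17 - 2*t := by linarith
    have h2 : 0 < 1 - t := by linarith
    positivity
  have hrS : 16 * (r * S) ≤ m * (16 * r^2) + n * S^2 := by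
    refine le_of_abs_le (abs_le_of_sq_le_sq ?_ (by positivity))
    nlinarith [sq_nonneg (m * (16 * r^2) - n * S^2), sq_nonneg (r * S)]
  have hcc : cForm m n p t 1 ≤ 16 * c := by
    have := mul_le_mul_of_nonneg_right hrS (by linarith : (0:ℝ) ≤ 1 + p)
    rw [hr, hS] at this
    unfold cForm
    rw [hc]
    linarith
  have hc0 : 0 < c := by linarith
  set N := (slopeForm p 1 * S / 16)^2 / c + r^2 with hN
  have hN0 : 0 ≤ N := by positivity
  have hNle : N ≤ (slopeForm p 1 * S / 16)^2 / (cForm m n p t 1 / 16) + r^2 := by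
    have : cForm m n p t 1 / 16 ≤ c := by linarith
    rw [hN]
    gcongr
  have hDN : dForm α β t 1 * N ≤ 16 * D * N := mul_le_mul_of_nonneg_right hD hN0
  rcases le_or_gt 0 (dForm α β t 1) with hd | hd
  · have := mul_nonneg hd hN0
    linarith
  · have h1 := mul_le_mul_of_nonpos_left hNle hd.le
    have h2 : (17 - 2*t)^2 * t * (1 - t) / 256 + dForm α β t 1 / 16 *
        ((slopeForm p 1 * S / 16)^2 / (cForm m n p t 1 / 16) + r^2)
        = IForm m n α β p t 1 / (256 * cForm m n p t 1) := by
      have hr' : r^2 = hillForm p t 1 / 16 := by linarith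
      rw [hr', div_pow, mul_pow, hS, IForm]
      field_simp
      ring
    have h3 : 0 < IForm m n α β p t 1 / (256 * cForm m n p t 1) := by positivity
    linarith

section Region

variable {p t : ℝ}

theorem le_of_hillForm_nonneg_small (hp : 0 ≤ p) (hp' : p ≤ 9/10) (hW : 0 ≤ hillForm p t 1) :
    p ≤ 5/4 * t := by
  unfold hillForm barrierForm at hW
  have h : 0 ≤ p^2 * (11 - 4*p - p^2) := mul_nonneg (sq_nonneg p) (by nlinarith)
  nlinarith [sq_nonneg t]

theorem le_of_hillForm_nonneg_large (hp : 0 ≤ p) (hp' : p ≤ 9/10) (ht : 1/5 ≤ t) (ht' : t ≤ 7/10)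
    (hW : 0 ≤ hillForm p t 1) : p ≤ 2/25 + 19/25 * t := by
  by_contra! hlt
  set L := 2/25 + 19/25 * t with hL
  have hL0 : 0 ≤ L := by linarith
  have hmono : barrierForm L 1 ≤ barrierForm p 1 := by
    have h : 0 ≤ (p - L) * (14 + 11*(p + L) - 4*(p^2 + p*L + L^2) - (p + L)*(p^2 + L^2)) := by
      refine mul_nonneg (by linarith) ?_
      have h1 : p^2 ≤ 9/10 * p := by nlinarith
      have h2 : L^2 ≤ 9/10 * L := by nlinarith
      have h3 : p * L ≤ 9/10 * p := by nlinarith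
      nlinarith
    unfold barrierForm
    linarith
  have hLt : 17*t - t^2 < barrierForm L 1 := by
    unfold barrierForm
    rw [hL]
    nlinarith [mul_nonneg (sub_nonneg.2 ht) (sub_nonneg.2 ht'), sq_nonneg (t - 2/5),
      mul_nonneg (mul_nonneg (sub_nonneg.2 ht) (sub_nonneg.2 ht')) (sub_nonneg.2 ht')]
  unfold hillForm at hW
  linarith

theorem le_of_barrierForm_le (hp' : p ≤ 9/10) (hG : barrierForm p 1 ≤ 16) :
    p ≤ 41/50 := by
  by_contra! hlt
  unfold barrierForm at hG
  nlinarith [mul_nonneg (sub_nonneg.2 hlt.le) (sub_nonneg.2 hp'), pow_pos (sub_pos.2 hlt) 2]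

theorem c_pos {r S : ℝ} (hp : 0 ≤ p) (hp' : p ≤ 9/10) (ht1 : t ≤ 1)
    (hS : S^2 = sinhSqForm p 1) (hr : 16 * r^2 = hillForm p t 1) :
    0 < hessForm p 1 - 16 * (r * S) * (1 + p) := by
  have hW : hillForm p t 1 ≤ 16 - barrierForm p 1 := by
    unfold hillForm
    nlinarith
  have hp2 : p ≤ 41/50 := le_of_barrierForm_le hp' (by nlinarith [sq_nonneg r])
  have hv : (0:ℝ) ≤ 50/41 * p := by linarith
  have hu : (0:ℝ) ≤ 1 - 50/41 * p := by linarith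
  have h1 := hessForm_pos_aux hu hv
  have h2 := hessForm_sq_aux hu hv
  rw [show 41/50 * (50/41 * p) = p by ring, show 1 - 50/41 * p + 50/41 * p = 1 by ring] at h1 h2
  have hX : 0 ≤ hessForm p 1 := by linarith
  refine sub_pos.2 (lt_of_abs_lt (abs_lt_of_sq_lt_sq ?_ hX))
  have hS0 : 0 ≤ sinhSqForm p 1 := hS ▸ sq_nonneg S
  calc (16 * (r * S) * (1 + p))^2 = 16 * (hillForm p t 1) * (1 + p)^2 * sinhSqForm p 1 := by
        rw [← hr, ← hS]; ring
    _ ≤ 16 * (16 - barrierForm p 1) * (1 + p)^2 * sinhSqForm p 1 := by gcongr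
    _ < hessForm p 1 ^ 2 := by linarith

theorem forms_pos_small (hp : 0 ≤ p) (hp' : p ≤ 5/4 * t) (ht : 0 < t) (ht' : t ≤ 1/5) :
    0 < cForm (11/20) (80/11) p t 1 ∧ 0 < IForm (11/20) (80/11) (1031/250) (109/50) p t 1 := by
  have hz : (0:ℝ) ≤ 1 - 5*t := by linarith
  rcases le_total p (7/20 * t) with h | h
  · have hv : (0:ℝ) ≤ 20/7 * p := by linarith
    have hu : (0:ℝ) ≤ t - 20/7 * p := by linarith
    have h1 := cForm_small_low hu hv hz
    have h2 := IForm_small_low hu hv hz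
    rw [sub_add_cancel, sub_add_cancel, show 7/20 * (20/7 * p) = p by ring] at h1 h2
    exact ⟨by linarith, by nlinarith⟩
  · have hv : (0:ℝ) ≤ 10/9 * (p - 7/20*t) := by linarith
    have hu : (0:ℝ) ≤ 10/9 * (5/4*t - p) := by linarith
    have h1 := cForm_small_high hu hv hz
    have h2 := IForm_small_high hu hv hz
    rw [show 10/9 * (5/4*t - p) + 10/9 * (p - 7/20*t) = t by ring, sub_add_cancel,
      show 7/20 * (10/9 * (5/4*t - p)) + 5/4 * (10/9 * (p - 7/20*t)) = p by ring] at h1 h2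
    exact ⟨by linarith, by nlinarith⟩

theorem forms_pos_mid (hp : 0 ≤ p) (hp' : p ≤ 2/25 + 19/25 * t) (ht : 1/5 ≤ t) (ht' : t ≤ 3/5) :
    0 < cForm (13/20) (80/13) p t 1 ∧ 0 < IForm (13/20) (80/13) (1031/250) (109/50) p t 1 := by
  have hL : 0 < 2/25 + 19/25 * t := by linarith
  have hq : 0 ≤ p / (2/25 + 19/25 * t) := by positivity
  have hs : 0 ≤ 1 - p / (2/25 + 19/25 * t) := sub_nonneg.2 ((div_le_one hL).2 hp')
  have hy : 0 ≤ 5/2 * (3/5 - t) := by linarith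
  have hz : 0 ≤ 5/2 * (t - 1/5) := by linarith
  have h1 := cForm_mid hq hs hy hz
  have h2 := IForm_mid hq hs hy hz
  rw [show 5/2 * (3/5 - t) + 5/2 * (t - 1/5) = 1 by ring,
    show 1/5 * (5/2 * (3/5 - t)) + 3/5 * (5/2 * (t - 1/5)) = t by ring, add_sub_cancel,
    mul_one (2/25 : ℝ), div_mul_cancel₀ _ hL.ne', mul_one, mul_one] at h1 h2
  exact ⟨by linarith, by linarith⟩

theorem forms_pos_large (hp : 0 ≤ p) (hp' : p ≤ 2/25 + 19/25 * t) (ht : 3/5 ≤ t)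
    (ht' : t ≤ 7/10) :
    0 < cForm (3/5) (20/3) p t 1 ∧ 0 < IForm (3/5) (20/3) (453/100) (82/25) p t 1 := by
  have hL : 0 < 2/25 + 19/25 * t := by linarith
  have hq : 0 ≤ p / (2/25 + 19/25 * t) := by positivity
  have hs : 0 ≤ 1 - p / (2/25 + 19/25 * t) := sub_nonneg.2 ((div_le_one hL).2 hp')
  have hy : 0 ≤ 10 * (7/10 - t) := by linarith
  have hz : 0 ≤ 10 * (t - 3/5) := by linarith
  have h1 := cForm_large hq hs hy hz
  have h2 := IForm_large hq hs hy hz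
  rw [show 10 * (7/10 - t) + 10 * (t - 3/5) = 1 by ring,
    show 3/5 * (10 * (7/10 - t)) + 7/10 * (10 * (t - 3/5)) = t by ring, add_sub_cancel,
    mul_one (2/25 : ℝ), div_mul_cancel₀ _ hL.ne', mul_one, mul_one] at h1 h2
  exact ⟨by linarith, by linarith⟩

end Region

/-- `I₀ > 0` in terms of `p = cosh x₁ - 1`, `t = cos² x₂`, `S = sinh x₁` and
`k = 4 r̃ sin x₂ cos x₂`. -/
theorem I_pos_algebraic {p t r S k : ℝ} (hp : 0 ≤ p) (hp' : p ≤ 9/10) (ht0 : 0 < t) (ht1 : t ≤ 1)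
    (hS : S^2 = sinhSqForm p 1) (hr : 16 * r^2 = hillForm p t 1)
    (hk : k^2 = t^2 * ((17 - t) * (1 - t))) :
    0 < (17 - 2*t)^2 * t * (1 - t) / 256 + (-17 + 40*t - 8*t^2 - 4*k) / 16 *
      ((slopeForm p 1 * S / 16)^2 / ((hessForm p 1 - 16 * (r * S) * (1 + p)) / 16) + r^2) := by
  have hc := c_pos hp hp' ht1 hS hr
  have hD {α β : ℝ} (h0 : 0 ≤ α - β * t) (h : (17 - t) * (1 - t) ≤ (α - β * t)^2) :
      dForm α β t 1 ≤ 16 * ((-17 + 40*t - 8*t^2 - 4*k) / 16) := by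
    have hkle : k ≤ t * (α - β * t) := by
      refine le_of_abs_le (abs_le_of_sq_le_sq ?_ (by positivity))
      rw [hk, mul_pow]
      gcongr
    unfold dForm
    linarith
  have hD₁ : dForm (1031/250) (109/50) t 1 ≤ 16 * ((-17 + 40*t - 8*t^2 - 4*k) / 16) :=
    hD (by linarith) (by nlinarith)
  have hD₂ : dForm (453/100) (82/25) t 1 ≤ 16 * ((-17 + 40*t - 8*t^2 - 4*k) / 16) :=
    hD (by linarith) (by nlinarith [sq_nonneg (t - 3/5)])
  have hW : 0 ≤ hillForm p t 1 := by rw [← hr]; positivity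
  have hc' : 16 * ((hessForm p 1 - 16 * (r * S) * (1 + p)) / 16)
      = hessForm p 1 - 16 * (r * S) * (1 + p) := by ring
  rcases le_total t (1/5) with h | h
  · obtain ⟨h1, h2⟩ := forms_pos_small hp (le_of_hillForm_nonneg_small hp hp' hW) ht0 h
    exact I_pos_of_forms (by norm_num) (by norm_num) (by norm_num) hp ht0 (by linarith) hS hr hc'
      hD₁ h1 h2
  rcases le_total t (3/5) with h' | h'
  · obtain ⟨h1, h2⟩ := forms_pos_mid hp
      (le_of_hillForm_nonneg_large hp hp' h (by linarith) hW) h h'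
    exact I_pos_of_forms (by norm_num) (by norm_num) (by norm_num) hp ht0 (by linarith) hS hr hc'
      hD₁ h1 h2
  rcases le_total t (7/10) with h'' | h''
  · obtain ⟨h1, h2⟩ := forms_pos_large hp (le_of_hillForm_nonneg_large hp hp' h h'' hW) h' h''
    exact I_pos_of_forms (by norm_num) (by norm_num) (by norm_num) hp ht0 (by linarith) hS hr hc'
      hD₂ h1 h2
  have hd : 0 < dForm (453/100) (82/25) t 1 := by unfold dForm; nlinarith
  have hD0 : 0 < (-17 + 40*t - 8*t^2 - 4*k) / 16 := by linarith
  have hV2 : 0 ≤ (17 - 2*t)^2 * t * (1 - t) / 256 := by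
    have : 0 ≤ 1 - t := by linarith
    positivity
  refine add_pos_of_nonneg_of_pos hV2 (mul_pos hD0 ?_)
  rcases hp.eq_or_lt with rfl | hp0
  · have : 0 < r^2 := by
      unfold hillForm barrierForm at hr
      nlinarith
    positivity
  · have hS0 : S ≠ 0 := by
      rintro rfl
      unfold sinhSqForm at hS
      nlinarith
    have hsl : slopeForm p 1 ≠ 0 := by
      have : 0 < slopeForm p 1 := by
        have h1 : p^2 ≤ p := by nlinarith
        have h2 : p^3 ≤ p := by nlinarith
        unfold slopeForm
        linarith
      exact this.ne'
    have : 0 < (slopeForm p 1 * S / 16)^2 := by positivity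
    positivity

theorem hillForm_cosh (x₁ x₂ : ℝ) :
    16 * (-2 * Vpot (-2) x₁ x₂) = hillForm (cosh x₁ - 1) (cos x₂ ^ 2) 1 := by
  unfold Vpot hillForm barrierForm
  rw [Real.sinh_two_mul, Real.sin_two_mul, mul_pow, mul_pow, mul_pow, mul_pow, Real.sinh_sq,
    Real.sin_sq]
  ring

theorem V₁_eq_slopeForm (x₁ : ℝ) : V₁ (-2) x₁ = slopeForm (cosh x₁ - 1) 1 * sinh x₁ / 16 := by
  unfold V₁ slopeForm
  rw [Real.cosh_three_mul]
  ring

theorem V₁₁_eq_hessForm (x₁ : ℝ) : V₁₁ (-2) x₁ = hessForm (cosh x₁ - 1) 1 / 16 := by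
  unfold V₁₁ hessForm
  rw [show 4 * x₁ = 2 * (2 * x₁) by ring, Real.cosh_two_mul (2 * x₁), Real.sinh_two_mul,
    Real.cosh_two_mul, mul_pow, mul_pow, Real.sinh_sq]
  ring

theorem V₂_sq_eq (x₂ : ℝ) : V₂ (-2) x₂ ^ 2
    = (17 - 2 * cos x₂ ^ 2)^2 * cos x₂ ^ 2 * (1 - cos x₂ ^ 2) / 256 := by
  unfold V₂
  rw [Real.cos_two_mul, Real.sin_two_mul, ← Real.sin_sq]
  ring

theorem V₂₂_eq (x₂ : ℝ) :
    V₂₂ (-2) x₂ = (-17 + 40 * cos x₂ ^ 2 - 8 * (cos x₂ ^ 2)^2) / 16 := by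
  unfold V₂₂
  rw [show 4 * x₂ = 2 * (2 * x₂) by ring, Real.cos_two_mul (2 * x₂), Real.cos_two_mul]
  ring

theorem cos_ne_zero_of_Vpot_nonpos {x₁ x₂ : ℝ} (hx1 : 0 ≤ x₁) (hch : cosh x₁ ≤ 19/10)
    (hx2 : 0 ≤ x₂) (hx2' : x₂ ≤ π/2) (hV : Vpot (-2) x₁ x₂ ≤ 0) (hne : (x₁, x₂) ≠ (0, π/2)) :
    cos x₂ ≠ 0 := by
  intro h0
  have hx2eq : x₂ = π/2 := by
    by_contra h
    exact (Real.cos_pos_of_mem_Ioo ⟨by linarith [Real.pi_pos], lt_of_le_of_ne hx2' h⟩).ne' h0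
  have hx1pos : 0 < x₁ := lt_of_le_of_ne hx1 fun h => hne (by rw [← h, hx2eq])
  have hc1 := Real.one_lt_cosh.2 hx1pos.ne'
  have hW : 0 ≤ hillForm (cosh x₁ - 1) (cos x₂ ^ 2) 1 := by
    rw [← hillForm_cosh]
    linarith
  have := le_of_hillForm_nonneg_small (by linarith) (by linarith) hW
  rw [h0] at this
  linarith

/-- Lemma `I₀ > 0`: at the critical energy `h = −2`, away from the singular point
`(0, π/2)`, one has `I₀ = V₂² + D·(V₁²/c₋₁ + r²) > 0` on the Hill region, where
`D(x₂) = −r̃·sin x₂·cos x₂ + V₂₂` with `r̃ = √(−2·V₋₂(0, x₂))`. -/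
theorem I0_pos (x₁ x₂ : ℝ) (hx1 : 0 ≤ x₁) (hch : cosh x₁ ≤ 19/10)
    (hx2 : 0 ≤ x₂) (hx2' : x₂ ≤ π/2) (hV : Vpot (-2) x₁ x₂ ≤ 0)
    (hne : (x₁, x₂) ≠ (0, π/2)) :
    let r : ℝ := Real.sqrt (-2 * Vpot (-2) x₁ x₂)
    let rt : ℝ := Real.sqrt (-2 * Vpot (-2) 0 x₂)
    let c : ℝ := -(r * sinh x₁ * cosh x₁) + V₁₁ (-2) x₁
    let D : ℝ := -(rt * sin x₂ * cos x₂) + V₂₂ (-2) x₂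
    0 < (V₂ (-2) x₂)^2 + D * ((V₁ (-2) x₁)^2 / c + r^2) := by
  intro r rt c D
  have hcos := cos_ne_zero_of_Vpot_nonpos hx1 hch hx2 hx2' hV hne
  have ht0 : 0 < cos x₂ ^ 2 := by positivity
  have ht1 : cos x₂ ^ 2 ≤ 1 := Real.cos_sq_le_one x₂
  have hp : 0 ≤ cosh x₁ - 1 := by linarith [Real.one_le_cosh x₁]
  have hr : 16 * r^2 = hillForm (cosh x₁ - 1) (cos x₂ ^ 2) 1 := by
    rw [← hillForm_cosh, Real.sq_sqrt (by linarith)]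
  have hrt : 16 * rt^2 = cos x₂ ^ 2 * (17 - cos x₂ ^ 2) := by
    have h : 16 * (-2 * Vpot (-2) 0 x₂) = cos x₂ ^ 2 * (17 - cos x₂ ^ 2) := by
      rw [hillForm_cosh, Real.cosh_zero]
      unfold hillForm barrierForm
      ring
    rw [Real.sq_sqrt (by nlinarith), h]
  have hS : sinh x₁ ^ 2 = sinhSqForm (cosh x₁ - 1) 1 := by
    rw [Real.sinh_sq]
    unfold sinhSqForm
    ring
  have hk : (4 * (rt * sin x₂ * cos x₂))^2
      = (cos x₂ ^ 2)^2 * ((17 - cos x₂ ^ 2) * (1 - cos x₂ ^ 2)) := by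
    rw [← Real.sin_sq]
    linear_combination sin x₂ ^ 2 * cos x₂ ^ 2 * hrt
  have hmain := I_pos_algebraic hp (by linarith) ht0 ht1 hS hr hk
  have hc : c = (hessForm (cosh x₁ - 1) 1
      - 16 * (r * sinh x₁) * (1 + (cosh x₁ - 1))) / 16 := by
    simp only [c, V₁₁_eq_hessForm]
    ring
  have hD : D = (-17 + 40 * cos x₂ ^ 2 - 8 * (cos x₂ ^ 2)^2
      - 4 * (4 * (rt * sin x₂ * cos x₂))) / 16 := by
    simp only [D, V₂₂_eq]
    ring
  rwa [V₂_sq_eq, V₁_eq_slopeForm, hc, hD]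
end

section
/- For every s ∈ [0, 1], (1 − s²)(4 + 2s² + s⁴) ≤ √((1 − s²)(17 − s²)) ≤ 33/8 − 2s² − s⁴. -/
/-- Two-sided polynomial bounds on `√((1 − s²)(17 − s²))` for `s ∈ [0,1]`. -/
theorem sqrt_sandwich (s : ℝ) (hs : s ∈ Set.Icc (0 : ℝ) 1) :
    (1 - s^2) * (4 + 2*s^2 + s^4) ≤ Real.sqrt ((1 - s^2) * (17 - s^2)) ∧
    Real.sqrt ((1 - s^2) * (17 - s^2)) ≤ 33/8 - 2*s^2 - s^4 := by
  obtain ⟨t, ht⟩ : ∃ t, t = s ^ 2 := ⟨_, rfl⟩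
  have h4 : s ^ 4 = t ^ 2 := by rw [ht]; ring
  have h0 : 0 ≤ t := ht ▸ sq_nonneg s
  have h1 : t ≤ 1 := ht ▸ pow_le_one₀ hs.1 hs.2
  rw [h4, ← ht]
  constructor
  · apply Real.le_sqrt_of_sq_le
    have key : (1 - t) * (4 + 2 * t + t ^ 2) ^ 2 ≤ 17 - t := by
      have h3 : 0 ≤ 8 * t ^ 3 + 3 * t ^ 4 + t ^ 5 := by positivity
      nlinarith [sq_nonneg (4 * t - 1 / 2)]
    calc ((1 - t) * (4 + 2 * t + t ^ 2)) ^ 2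
        = (1 - t) * ((1 - t) * (4 + 2 * t + t ^ 2) ^ 2) := by ring
      _ ≤ (1 - t) * (17 - t) := mul_le_mul_of_nonneg_left key (sub_nonneg.2 h1)
  · apply Real.sqrt_le_iff.2
    constructor
    · nlinarith
    · have h3 : 0 ≤ (t - 6 / 11) ^ 2 * (t ^ 2 + 56 / 11 * t) := by positivity
      nlinarith [sq_nonneg t]
end

section
/- For every s ∈ [0, 1], 85 − 26s² + s⁴ − (17 − s²)·√((1 − s²)(17 − s²)) ≥ 85 − 17^{3/2} > 59/4. -/
/-- Lower bound for `j₁(s) = 85 − 26s² + s⁴ − (17 − s²)√((1 − s²)(17 − s²))`: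
it is at least `85 − 17^{3/2}`, which is greater than `59/4`, for all `s ∈ [0,1]`. -/
theorem j1_lower_bound (s : ℝ) (hs : s ∈ Set.Icc (0 : ℝ) 1) :
    85 - 17 * Real.sqrt 17 ≤
      85 - 26*s^2 + s^4 - (17 - s^2) * Real.sqrt ((1 - s^2) * (17 - s^2)) ∧
    (59 : ℝ)/4 < 85 - 17 * Real.sqrt 17 := by
  obtain ⟨h0, h1⟩ := hs
  have ht0 : 0 ≤ s ^ 2 := sq_nonneg s
  have ht1 : s ^ 2 ≤ 1 := pow_le_one₀ h0 h1
  have hr : (4 : ℝ) ≤ Real.sqrt 17 := Real.le_sqrt_of_sq_le (by norm_num)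
  have hr_sq : Real.sqrt 17 ^ 2 = 17 := Real.sq_sqrt (by norm_num)
  have hsqrt : Real.sqrt ((1 - s ^ 2) * (17 - s ^ 2)) ≤ Real.sqrt 17 * (1 - s ^ 2 / 2) := by
    apply Real.sqrt_le_iff.mpr
    refine ⟨mul_nonneg (by linarith) (by linarith), ?_⟩
    rw [mul_pow, hr_sq]
    nlinarith [sq_nonneg (s ^ 2)]
  constructor
  · have hmul := mul_le_mul_of_nonneg_left hsqrt (by linarith : 0 ≤ 17 - s ^ 2)
    have hgap : 0 ≤ s ^ 2 * (Real.sqrt 17 * (19 / 2 - s ^ 2 / 2) - (26 - s ^ 2)) := by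
      apply mul_nonneg ht0
      nlinarith [mul_nonneg (sub_nonneg.mpr hr) (by linarith : 0 ≤ 19 / 2 - s ^ 2 / 2)]
    linarith
  · nlinarith
end

section
/- For every s ∈ [0, 1] and every c ∈ [0, √(17/14)], let j_{2,0}(s, c) := 169/32 − (c² − 1/4)·(5/2 + s²/4 + c²) − c⁴s²/2. Then j_{2,0}(s, c) > 0 and j_{2,0}(s, c)² > (2 + c²s²)·(17 − 14c² − s² − 11c⁴s² + 4c⁶s⁴ + c⁸s⁶). -/
theorem quartic_at_zero_pos {x : ℝ} (h0 : 0 ≤ x) :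
    0 < 905/1024 + 91/64*x - 27/4*x^2 + 9/2*x^3 + x^4 := by
  nlinarith [mul_nonneg h0 (sq_nonneg (x - 7/10)), sq_nonneg (x^2 - 1/2),
    sq_nonneg (x - 7/10)]

theorem quartic_tangent_pos {x : ℝ} (h0 : 0 ≤ x) :
    0 < 905/1024 + 91/64*x - 27/4*x^2 + 9/2*x^3 + x^4 +
      (701/256 - 1295/64*x + 995/32*x^2 + 11/4*x^3 + x^4) := by
  nlinarith [mul_nonneg h0 (sq_nonneg (x - 7/20)), sq_nonneg (x^2),
    sq_nonneg (x - 7/20)]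

theorem quintic_at_one_pos {x : ℝ} (h0 : 0 ≤ x) (h1 : x ≤ 17/14) :
    0 < 905/1024 + 91/64*x - 27/4*x^2 + 9/2*x^3 + x^4 +
      (701/256 - 1295/64*x + 995/32*x^2 + 11/4*x^3 + x^4) +
      (1/256 + 31/32*x + 13/4*x^3 - 23/4*x^4 - x^5) := by
  have h2 : 0 ≤ x^3 * (17/14 - x) := mul_nonneg (by positivity) (by linarith)
  have h3 : 0 ≤ x^4 * (17/14 - x) := mul_nonneg (by positivity) (by linarith)
  nlinarith [mul_nonneg h0 (sq_nonneg (x - 1/3)), sq_nonneg (x - 1/3), pow_nonneg h0 3]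

theorem quadratic_pos_of_endpoints {p q r t : ℝ} (hp : 0 < p) (hpq : 0 < p + q)
    (hpqr : 0 < p + q + r) (t0 : 0 ≤ t) (t1 : t ≤ 1) : 0 < p + t*q + t^2*r := by
  have interp {m : ℝ} (hm : 0 < m) : 0 < (1 - t) * p + t * m := by
    rcases t0.eq_or_lt with rfl | ht
    · simpa using hp
    · exact add_pos_of_nonneg_of_pos (mul_nonneg (by linarith) hp.le) (mul_pos ht hm)
  rcases le_total 0 r with hr | hr
  · linarith [interp hpq, mul_nonneg (sq_nonneg t) hr]
  · linarith [interp hpqr, mul_nonneg (mul_nonneg t0 (sub_nonneg.2 t1)) (neg_nonneg.2 hr)]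

theorem j20_sq_gap {x t : ℝ} (h0 : 0 ≤ x) (h1 : x ≤ 17/14) (t0 : 0 ≤ t) (t1 : t ≤ 1) :
    (2 + x*t) * (17 - 14*x - t - 11*x^2*t + 4*x^3*t^2 + x^4*t^3) <
      (169/32 - (x - 1/4) * (5/2 + t/4 + x) - x^2 * t / 2)^2 := by
  set p := 905/1024 + 91/64*x - 27/4*x^2 + 9/2*x^3 + x^4 with hp
  set q := 701/256 - 1295/64*x + 995/32*x^2 + 11/4*x^3 + x^4 with hq
  set r := 1/256 + 31/32*x + 13/4*x^3 - 23/4*x^4 - x^5 with hr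
  have p_pos : 0 < p := quartic_at_zero_pos h0
  have pq_pos : 0 < p + q := quartic_tangent_pos h0
  have pqr_pos : 0 < p + q + r := quintic_at_one_pos h0 h1
  have cubic : 0 ≤ 6 * x^4 * (t^2 * (1 - t)) :=
    mul_nonneg (by positivity) (mul_nonneg (by positivity) (by linarith))
  have quartic : 0 ≤ x^5 * (t^2 * (1 - t^2)) :=
    mul_nonneg (by positivity) (mul_nonneg (by positivity) (by nlinarith))
  have expand : (169/32 - (x - 1/4) * (5/2 + t/4 + x) - x^2 * t / 2)^2 -
      (2 + x*t) * (17 - 14*x - t - 11*x^2*t + 4*x^3*t^2 + x^4*t^3) =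
      p + t*q + t^2*r + 6 * x^4 * (t^2 * (1 - t)) + x^5 * (t^2 * (1 - t^2)) := by
    rw [hp, hq, hr]; ring
  have key := quadratic_pos_of_endpoints p_pos pq_pos pqr_pos t0 t1
  linarith

theorem j20_pos {x t : ℝ} (h0 : 0 ≤ x) (h1 : x ≤ 17/14) (t0 : 0 ≤ t) (t1 : t ≤ 1) :
    0 < 169/32 - (x - 1/4) * (5/2 + t/4 + x) - x^2 * t / 2 := by
  have hx : x^2 ≤ (17/14)^2 := pow_le_pow_left₀ h0 h1 2
  have hxt : x * t ≤ x := mul_le_of_le_one_right h0 t1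
  have hxxt : x^2 * t ≤ x^2 := mul_le_of_le_one_right (sq_nonneg x) t1
  nlinarith

/-- Part (iii) of Lemma 'estimates of fi': for `s ∈ [0,1]` and `c ∈ [0, √(17/14)]`,
the quantity `j_{2,0}(s,c)` is positive and its square strictly dominates
`j₂(s,c)² = (2 + c²s²)(17 − 14c² − s² − 11c⁴s² + 4c⁶s⁴ + c⁸s⁶)`. -/
theorem j20_dominates (s c : ℝ) (hs : s ∈ Set.Icc (0 : ℝ) 1)
    (hc : c ∈ Set.Icc (0 : ℝ) (Real.sqrt (17/14))) :
    0 < 169/32 - (c^2 - 1/4) * (5/2 + s^2/4 + c^2) - c^4 * s^2 / 2 ∧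
    (2 + c^2*s^2) * (17 - 14*c^2 - s^2 - 11*c^4*s^2 + 4*c^6*s^4 + c^8*s^6) <
      (169/32 - (c^2 - 1/4) * (5/2 + s^2/4 + c^2) - c^4 * s^2 / 2)^2 := by
  have hx : c^2 ≤ 17/14 := (Real.le_sqrt hc.1 (by norm_num)).1 hc.2
  have ht : s^2 ≤ 1 := pow_le_one₀ hs.1 hs.2
  have pos := j20_pos (sq_nonneg c) hx (sq_nonneg s) ht
  have gap := j20_sq_gap (sq_nonneg c) hx (sq_nonneg s) ht
  simp only [← pow_mul, Nat.reduceMul] at pos gap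
  exact ⟨pos, gap⟩
end

section
/- For every s ∈ [1, 3/2], E₀(s) := −187055 − 163474·s + 2863736·s² − 6584384·s³ + 6310408·s⁴ − 2469888·s⁵ + 98304·s⁶ + 131072·s⁷ − 16384·s⁸ < 0. -/
/-- The degree-8 integer polynomial `E₀` is negative on `[1, 3/2]`. -/
theorem E0_neg (s : ℝ) (hs : s ∈ Set.Icc (1 : ℝ) (3/2)) :
    -187055 - 163474*s + 2863736*s^2 - 6584384*s^3 + 6310408*s^4
      - 2469888*s^5 + 98304*s^6 + 131072*s^7 - 16384*s^8 < 0 := by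
  obtain ⟨h1, h2⟩ := hs
  obtain ⟨v, rfl⟩ : ∃ v, s = 1 + v := ⟨s - 1, by ring⟩
  have hv : 0 ≤ v := by linarith
  have hv2 : v ^ 2 ≤ 1 / 4 := by nlinarith
  have h6 : 0 ≤ v ^ 4 * (1 / 4 - v ^ 2) := mul_nonneg (by positivity) (by linarith)
  have h3 : 0 ≤ v * (v - 1 / 5) ^ 2 := by positivity
  have h4 : 0 ≤ (v ^ 2 - 1 / 25) ^ 2 := by positivity
  have h5 : 0 ≤ v ^ 5 := by positivity
  have h8 : 0 ≤ v ^ 8 := by positivity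
  have hq : 0 ≤ (v - 6 / 25) ^ 2 := by positivity
  ring_nf at h6 h3 h4 hq ⊢
  linarith
end

section
/- Let n ≥ 1 and let M be a real 2n×2n symplectic matrix, i.e. Mᵀ·J·M = J where J = [[0, −Iₙ], [Iₙ, 0]] in n×n blocks. Then there exists an infinitely differentiable path β : ℝ → Mat_{2n×2n}(ℝ) such that β(t) is symplectic for every t ∈ [0, 1], β(0) = I_{2n}, β(1) = M, and for every t ∈ [0, 1] the matrix −J·β'(t)·β(t)⁻¹ is symmetric positive semidefinite. -/
open Matrix

namespace SymplecticGroup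

variable {l : Type*} [DecidableEq l] [Fintype l]

/-- The matrices that can be joined to the identity by a smooth path `β` of symplectic matrices
solving `β' = J S β` with `S` positive semidefinite. -/
def NonnegReachable (M : Matrix (l ⊕ l) (l ⊕ l) ℝ) : Prop :=
  ∃ β S : ℝ → Matrix (l ⊕ l) (l ⊕ l) ℝ,
    (∀ i j, ContDiff ℝ (⊤ : ℕ∞) (fun t => β t i j)) ∧
    (∀ t, β t ∈ symplecticGroup l ℝ) ∧
    (∀ t, (S t).PosSemidef) ∧
    (∀ t i j, HasDerivAt (fun s => β s i j) ((J l ℝ * S t * β t) i j) t) ∧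
    β 0 = 1 ∧ β 1 = M

theorem mul_J_eq_J_mul_transpose {R : Type*} [CommRing R] {G H : Matrix (l ⊕ l) (l ⊕ l) R}
    (hG : G ∈ symplecticGroup l R) (hGH : G * H = 1) : G * J l R = J l R * Hᵀ := by
  have h : Gᵀ * Hᵀ = 1 := by
    rw [← transpose_mul, mul_eq_one_comm.mp hGH, transpose_one]
  calc G * J l R = G * J l R * (Gᵀ * Hᵀ) := by rw [h, Matrix.mul_one]
    _ = (G * J l R * Gᵀ) * Hᵀ := by simp only [Matrix.mul_assoc]
    _ = J l R * Hᵀ := by rw [mem_iff.mp hG]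

theorem mem_of_mul_eq_one {R : Type*} [CommRing R] {G H : Matrix (l ⊕ l) (l ⊕ l) R}
    (hG : G ∈ symplecticGroup l R) (hGH : G * H = 1) : H ∈ symplecticGroup l R := by
  rw [mem_iff, Matrix.mul_assoc, ← mul_J_eq_J_mul_transpose hG hGH, ← Matrix.mul_assoc,
    mul_eq_one_comm.mp hGH, Matrix.one_mul]

theorem hasDerivAt_matrix_mul_apply {m n p : Type*} [Fintype n]
    {A : ℝ → Matrix m n ℝ} {B : ℝ → Matrix n p ℝ} {A' : Matrix m n ℝ} {B' : Matrix n p ℝ} {t : ℝ}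
    (hA : ∀ i j, HasDerivAt (fun s => A s i j) (A' i j) t)
    (hB : ∀ i j, HasDerivAt (fun s => B s i j) (B' i j) t) (i : m) (j : p) :
    HasDerivAt (fun s => (A s * B s) i j) ((A' * B t + A t * B') i j) t := by
  simp only [mul_apply, Matrix.add_apply, ← Finset.sum_add_distrib]
  exact HasDerivAt.fun_sum fun k _ => (hA i k).fun_mul (hB k j)

theorem contDiff_matrix_mul_apply {m n p : Type*} [Fintype n] {k : WithTop ℕ∞}
    {A : ℝ → Matrix m n ℝ} {B : ℝ → Matrix n p ℝ}
    (hA : ∀ i j, ContDiff ℝ k (fun s => A s i j))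
    (hB : ∀ i j, ContDiff ℝ k (fun s => B s i j)) (i : m) (j : p) :
    ContDiff ℝ k (fun s => (A s * B s) i j) := by
  simp only [mul_apply]
  exact ContDiff.sum fun q _ => (hA i q).mul (hB q j)

namespace NonnegReachable

variable {M N : Matrix (l ⊕ l) (l ⊕ l) ℝ}

theorem mul (hM : NonnegReachable M) (hN : NonnegReachable N) : NonnegReachable (M * N) := by
  obtain ⟨β, S, hβ, hβs, hS, hd, h0, h1⟩ := hM
  obtain ⟨γ, T, hγ, hγs, hT, he, k0, k1⟩ := hN
  have hinv (t) : β t * (β t)⁻¹ = 1 := mul_nonsing_inv _ (symplectic_det (hβs t))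
  refine ⟨fun t => β t * γ t, fun t => S t + ((β t)⁻¹)ᵀ * T t * (β t)⁻¹,
    contDiff_matrix_mul_apply hβ hγ, fun t => mul_mem (hβs t) (hγs t), fun t => ?_,
    fun t i j => ?_, by simp [h0, k0], by simp [h1, k1]⟩
  · refine (hS t).add ?_
    simpa using (hT t).conjTranspose_mul_mul_same (β t)⁻¹
  · convert hasDerivAt_matrix_mul_apply (hd t) (he t) i j using 1
    refine congrFun (congrFun ?_ i) j
    have h : (β t)⁻¹ * (β t * γ t) = γ t := by
      rw [← Matrix.mul_assoc, mul_eq_one_comm.mp (hinv t), Matrix.one_mul]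
    calc J l ℝ * (S t + ((β t)⁻¹)ᵀ * T t * (β t)⁻¹) * (β t * γ t)
        = J l ℝ * S t * β t * γ t
          + (J l ℝ * ((β t)⁻¹)ᵀ) * T t * ((β t)⁻¹ * (β t * γ t)) := by noncomm_ring
      _ = J l ℝ * S t * β t * γ t + β t * (J l ℝ * T t * γ t) := by
        rw [h, ← mul_J_eq_J_mul_transpose (hβs t) (hinv t)]; noncomm_ring

theorem conj {G H : Matrix (l ⊕ l) (l ⊕ l) ℝ} (hM : NonnegReachable M)
    (hG : G ∈ symplecticGroup l ℝ) (hGH : G * H = 1) : NonnegReachable (G * M * H) := by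
  obtain ⟨β, S, hβ, hβs, hS, hd, h0, h1⟩ := hM
  have hc (K : Matrix (l ⊕ l) (l ⊕ l) ℝ) (t : ℝ) (i j : l ⊕ l) :
      HasDerivAt (fun _ : ℝ => K i j) ((0 : Matrix (l ⊕ l) (l ⊕ l) ℝ) i j) t :=
    hasDerivAt_const t _
  refine ⟨fun t => G * β t * H, fun t => Hᵀ * S t * H,
    contDiff_matrix_mul_apply (contDiff_matrix_mul_apply (fun _ _ => contDiff_const) hβ)
      (fun _ _ => contDiff_const),
    fun t => mul_mem (mul_mem hG (hβs t)) (mem_of_mul_eq_one hG hGH), fun t => ?_,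
    fun t i j => ?_, by simp [h0, hGH], by simp [h1]⟩
  · simpa using (hS t).conjTranspose_mul_mul_same H
  · convert hasDerivAt_matrix_mul_apply
      (hasDerivAt_matrix_mul_apply (hc G t) (hd t)) (hc H t) i j using 1
    refine congrFun (congrFun ?_ i) j
    calc J l ℝ * (Hᵀ * S t * H) * (G * β t * H)
        = (J l ℝ * Hᵀ) * S t * (H * G) * β t * H := by noncomm_ring
      _ = _ := by
        rw [← mul_J_eq_J_mul_transpose hG hGH, mul_eq_one_comm.mp hGH]; simp [Matrix.mul_assoc]

theorem J : NonnegReachable (J l ℝ) := by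
  have hp : 0 ≤ Real.pi / 2 := by positivity
  refine ⟨fun t => Real.cos (Real.pi / 2 * t) • 1 + Real.sin (Real.pi / 2 * t) • Matrix.J l ℝ,
    fun _ => (Real.pi / 2) • 1, fun i j => ?_, fun t => ?_, fun _ => PosSemidef.one.smul hp,
    fun t i j => ?_, by simp, by simp⟩
  · simp only [Matrix.add_apply, Matrix.smul_apply, smul_eq_mul]
    fun_prop
  · rw [mem_iff]
    simp only [transpose_add, transpose_smul, transpose_one, J_transpose, add_mul, mul_add,
      Matrix.smul_mul, Matrix.mul_smul, Matrix.one_mul, Matrix.mul_one, Matrix.mul_neg,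
      J_squared, Matrix.neg_mul, smul_neg, neg_neg, smul_smul]
    ext i j
    simp only [Matrix.add_apply, Matrix.smul_apply, Matrix.neg_apply, smul_eq_mul]
    linear_combination (Matrix.J l ℝ i j) * Real.sin_sq_add_cos_sq (Real.pi / 2 * t)
  · have h : HasDerivAt (fun s => Real.pi / 2 * s) (Real.pi / 2) t := by
      simpa using (hasDerivAt_id t).const_mul (Real.pi / 2)
    refine ((h.cos.mul_const ((1 : Matrix (l ⊕ l) (l ⊕ l) ℝ) i j)).fun_add
      (h.sin.mul_const (Matrix.J l ℝ i j))).congr_deriv ?_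
    simp only [Matrix.mul_smul, Matrix.smul_mul, Matrix.mul_one, mul_add, J_squared]
    simp only [Matrix.add_apply, Matrix.smul_apply, Matrix.neg_apply, smul_eq_mul]
    ring

theorem lower_of_posSemidef {B : Matrix l l ℝ} (hB : B.PosSemidef) :
    NonnegReachable (fromBlocks 1 0 B 1) := by
  have hB' : Bᵀ = B := by simpa using hB.isHermitian.eq
  refine ⟨fun t => fromBlocks 1 0 (t • B) 1, fun _ => fromBlocks B 0 0 0, ?_, fun t => ?_,
    fun _ => ?_, ?_, by simp, by simp⟩
  · rintro (i | i) (j | j) <;> simp <;> fun_prop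
  · simp [fromBlocks_mem_iff, hB']
  · convert hB.conjTranspose_mul_mul_same (fromCols (1 : Matrix l l ℝ) (0 : Matrix l l ℝ)) using 1
    rw [conjTranspose_fromCols_eq_fromRows_conjTranspose, fromRows_mul, fromRows_mul_fromCols]
    simp
  · rintro t (i | i) (j | j) <;>
      simp [Matrix.J, fromBlocks_multiply, hasDerivAt_const]
    simpa using (hasDerivAt_id t).mul_const (B i j)

theorem conj_J_lower {B : Matrix l l ℝ} (hB : NonnegReachable (fromBlocks 1 0 B 1)) :
    NonnegReachable (fromBlocks 1 (-B) 0 1) := by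
  convert hB.conj (J_mem l ℝ) (H := -Matrix.J l ℝ) (by simp [J_squared]) using 1
  simp [Matrix.J, fromBlocks_multiply, fromBlocks_neg]

theorem neg (hM : NonnegReachable M) : NonnegReachable (-M) := by
  simpa [J_squared] using (J.mul J).mul hM

theorem squeeze : NonnegReachable (fromBlocks ((2 : ℝ) • 1) 0 0 ((1 / 2 : ℝ) • 1) :
    Matrix (l ⊕ l) (l ⊕ l) ℝ) := by
  have hL : NonnegReachable (fromBlocks 1 0 ((3 / 2 : ℝ) • 1) 1 : Matrix (l ⊕ l) (l ⊕ l) ℝ) :=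
    lower_of_posSemidef (PosSemidef.one.smul (by norm_num))
  have hU : NonnegReachable (fromBlocks 1 (-((3 : ℝ) • 1)) 0 1 : Matrix (l ⊕ l) (l ⊕ l) ℝ) :=
    conj_J_lower (lower_of_posSemidef (PosSemidef.one.smul (by norm_num)))
  convert ((hL.mul hU).conj (G := fromBlocks (-1) ((2 : ℝ) • 1) (-1) 1)
    (H := fromBlocks 1 (-((2 : ℝ) • 1)) 1 (-1)) ?_ ?_).neg using 1
  · simp only [fromBlocks_multiply, fromBlocks_neg]
    congr 1 <;> simp [smul_smul] <;> module
  · rw [fromBlocks_mem_iff]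
    refine ⟨by simp, by simp, ?_⟩
    simp
    module
  · rw [fromBlocks_multiply, ← fromBlocks_one]
    congr 1 <;> simp <;> module

theorem squeeze_symm : NonnegReachable (fromBlocks ((1 / 2 : ℝ) • 1) 0 0 ((2 : ℝ) • 1) :
    Matrix (l ⊕ l) (l ⊕ l) ℝ) := by
  convert squeeze.conj (J_mem l ℝ) (H := -Matrix.J l ℝ) (by simp [J_squared]) using 1
  simp [Matrix.J, fromBlocks_multiply, fromBlocks_neg]

theorem lower {B : Matrix l l ℝ} (hB : B.IsSymm) : NonnegReachable (fromBlocks 1 0 B 1) := by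
  convert squeeze.mul (squeeze_symm.conj (G := fromBlocks 1 0 (-((4 / 3 : ℝ) • B)) 1)
    (H := fromBlocks 1 0 ((4 / 3 : ℝ) • B) 1) ?_ ?_) using 1
  · simp only [fromBlocks_multiply]
    congr 1 <;> simp [smul_smul]
    module
  · simp [fromBlocks_mem_iff, hB.eq]
  · simp [fromBlocks_multiply]

theorem upper {B : Matrix l l ℝ} (hB : B.IsSymm) : NonnegReachable (fromBlocks 1 B 0 1) := by
  simpa using conj_J_lower (lower hB.neg)

theorem blockDiagonal_of_isSymm {A B : Matrix l l ℝ} (hA : A.IsSymm) (hAB : A * B = 1) :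
    NonnegReachable (fromBlocks A 0 0 B) := by
  have hBA : B * A = 1 := mul_eq_one_comm.mp hAB
  have hB : B.IsSymm := by
    have h : Bᵀ * A = 1 := by rw [← hA.eq, ← transpose_mul, hAB, transpose_one]
    exact left_inv_eq_right_inv h hAB
  convert J.mul (((upper hB).mul (lower hA.neg)).mul (upper hB)) using 1
  simp [Matrix.J, fromBlocks_multiply, hAB, hBA]

theorem blockDiagonal_transvection (t : TransvectionStruct l ℝ) :
    NonnegReachable (fromBlocks t.toMatrix 0 0 (t.toMatrix⁻¹)ᵀ) := by
  obtain ⟨i, j, hij, c⟩ := t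
  set D : Matrix l l ℝ := diagonal (Function.update 1 i 2) with hD
  set E : Matrix l l ℝ := diagonal (Function.update 1 i (1 / 2)) with hE
  have hDE : D * E = 1 := by
    rw [hD, hE, diagonal_mul_diagonal, ← diagonal_one]
    congr 1
    ext k
    by_cases hk : k = i <;> simp [hk]
  have hscale (x : ℝ) : D * transvection i j x * E = transvection i j (2 * x) := by
    ext a b
    rw [hD, hE, mul_diagonal, diagonal_mul]
    by_cases ha : a = i <;> by_cases hb : b = i <;>
      simp [transvection, single_apply, one_apply, ha, hb, hij.symm, eq_comm] <;> grind
  have hinv (x : ℝ) : transvection i j x * transvection i j (-x) = 1 := by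
    simp [transvection_mul_transvection_same, hij]
  have hinv' : (transvection i j c)⁻¹ = transvection i j (-c) := inv_eq_right_inv (hinv c)
  have hneg : transvection i j (-c) * transvection i j c = 1 := by simpa using hinv (-c)
  have hG : fromBlocks (transvection i j c) 0 0 (transvection i j (-c))ᵀ
      ∈ symplecticGroup l ℝ := by
    simp [fromBlocks_mem_iff, ← transpose_mul, hneg]
  have hGH : fromBlocks (transvection i j c) 0 0 (transvection i j (-c))ᵀ *
      fromBlocks (transvection i j (-c)) 0 0 (transvection i j c)ᵀ = 1 := by
    simp [fromBlocks_multiply, ← transpose_mul, hinv]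
  have hDs : D.IsSymm := isSymm_diagonal _
  have hEs : E.IsSymm := isSymm_diagonal _
  convert (blockDiagonal_of_isSymm hDs hDE).mul ((blockDiagonal_of_isSymm hEs
    (mul_eq_one_comm.mp hDE)).conj hG hGH) using 1
  rw [TransvectionStruct.toMatrix_mk, hinv']
  simp only [fromBlocks_multiply, Matrix.mul_zero, Matrix.zero_mul, add_zero, zero_add]
  congr 1
  · rw [← Matrix.mul_assoc, ← Matrix.mul_assoc, hscale, transvection_mul_transvection_same _ _ hij]
    congr 1
    ring
  · rw [← transpose_inj]
    simp only [transpose_mul, transpose_transpose, hDs.eq, hEs.eq]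
    rw [Matrix.mul_assoc, hscale,
      transvection_mul_transvection_same _ _ hij]
    congr 1
    ring

theorem blockDiagonal {A : Matrix l l ℝ} (hA : A.det ≠ 0) :
    NonnegReachable (fromBlocks A 0 0 (A⁻¹)ᵀ) := by
  refine diagonal_transvection_induction_of_det_ne_zero
    (fun A => NonnegReachable (fromBlocks A 0 0 (A⁻¹)ᵀ)) A hA (fun D hD => ?_)
    blockDiagonal_transvection fun A B _ _ hPA hPB => ?_
  · have hD' : IsUnit (diagonal D).det := hD.isUnit
    refine blockDiagonal_of_isSymm (isSymm_diagonal D) ?_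
    rw [transpose_nonsing_inv, diagonal_transpose, mul_nonsing_inv _ hD']
  · convert hPA.mul hPB using 1
    simp [fromBlocks_multiply, Matrix.mul_inv_rev]

end NonnegReachable

/-- Multiplication by a suitable symplectic upper shear makes the upper left block invertible. -/
theorem exists_det_add_smul_ne_zero {A B C D : Matrix l l ℝ}
    (h : fromBlocks A B C D ∈ symplecticGroup l ℝ) : ∃ x : ℝ, (A + x • C).det ≠ 0 := by
  by_contra! hx
  have hpos : (Aᵀ * A + Cᵀ * C).PosDef := by
    have hinj : Function.Injective (fromBlocks A B C D).mulVec :=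
      mulVec_injective_of_isUnit ((isUnit_iff_isUnit_det _).2 (symplectic_det h))
    convert (PosDef.conjTranspose_mul_self _ hinj).submatrix (Sum.inl_injective (β := l)) using 1
    rw [conjTranspose_eq_transpose_of_trivial, fromBlocks_transpose, fromBlocks_multiply]
    rfl
  let f := Complex.ofRealHom.mapMatrix (m := l)
  let p : Polynomial ℂ :=
    ((f A).map Polynomial.C + (Polynomial.X : Polynomial ℂ) • (f C).map Polynomial.C).det
  have heval (z : ℂ) : p.eval z = (f A + z • f C).det := by
    rw [← Polynomial.coe_evalRingHom, RingHom.map_det]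
    congr 1
    ext i j
    simp [mul_comm z]
  have hp : p = 0 := by
    refine Polynomial.eq_zero_of_infinite_isRoot p
      ((Set.infinite_range_of_injective Complex.ofReal_injective).mono ?_)
    rintro _ ⟨x, rfl⟩
    have hfx : f A + (x : ℂ) • f C = f (A + x • C) := by
      ext i j
      simp [f]
    change p.eval _ = 0
    rw [heval, hfx, ← RingHom.map_det, hx, map_zero]
  have hI : (f A + Complex.I • f C).det = 0 := by rw [← heval, hp, Polynomial.eval_zero]
  have hprod : (f Aᵀ - Complex.I • f Cᵀ) * (f A + Complex.I • f C) = f (Aᵀ * A + Cᵀ * C) := by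
    have hsymm : f Aᵀ * f C = f Cᵀ * f A := by
      rw [← map_mul, ← map_mul, (fromBlocks_mem_iff.1 h).1]
    simp only [map_add, map_mul, sub_mul, mul_add, Matrix.smul_mul, Matrix.mul_smul, smul_smul,
      Complex.I_mul_I, hsymm]
    module
  have hdet := congrArg det hprod
  rw [det_mul, hI, mul_zero, ← RingHom.map_det] at hdet
  exact hpos.det_pos.ne' (Complex.ofReal_injective (by simpa using hdet.symm))

theorem nonnegReachable_of_det_ne_zero {A B C D : Matrix l l ℝ}
    (h : fromBlocks A B C D ∈ symplecticGroup l ℝ) (hA : A.det ≠ 0) :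
    NonnegReachable (fromBlocks A B C D) := by
  have hAi : A * A⁻¹ = 1 := mul_nonsing_inv _ hA.isUnit
  have hiA : A⁻¹ * A = 1 := nonsing_inv_mul _ hA.isUnit
  have hiAT : (A⁻¹)ᵀ * Aᵀ = 1 := by rw [← transpose_mul, hAi, transpose_one]
  have hATi : Aᵀ * (A⁻¹)ᵀ = 1 := by rw [← transpose_mul, hiA, transpose_one]
  obtain ⟨hAC, -, hAD⟩ := fromBlocks_mem_iff.1 h
  have hAB : A * Bᵀ = B * Aᵀ := by
    have h' := transpose_mem h
    rw [fromBlocks_transpose, fromBlocks_mem_iff] at h'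
    simpa using h'.1
  have hCA : (A⁻¹)ᵀ * Cᵀ = C * A⁻¹ := by
    calc (A⁻¹)ᵀ * Cᵀ = (A⁻¹)ᵀ * (Cᵀ * A) * A⁻¹ := by simp only [Matrix.mul_assoc, hAi, mul_one]
      _ = ((A⁻¹)ᵀ * Aᵀ) * C * A⁻¹ := by rw [← hAC]; simp only [Matrix.mul_assoc]
      _ = C * A⁻¹ := by rw [hiAT, one_mul]
  have hBA : Bᵀ * (A⁻¹)ᵀ = A⁻¹ * B := by
    calc Bᵀ * (A⁻¹)ᵀ = A⁻¹ * (A * Bᵀ) * (A⁻¹)ᵀ := by rw [← Matrix.mul_assoc A⁻¹, hiA, one_mul]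
      _ = A⁻¹ * B * (Aᵀ * (A⁻¹)ᵀ) := by rw [hAB]; simp only [Matrix.mul_assoc]
      _ = A⁻¹ * B := by rw [hATi, mul_one]
  have hL : (C * A⁻¹).IsSymm := by rw [IsSymm, transpose_mul, hCA]
  have hU : (A⁻¹ * B).IsSymm := by rw [IsSymm, transpose_mul, hBA]
  have hD : D = C * A⁻¹ * B + (A⁻¹)ᵀ := by
    calc D = (A⁻¹)ᵀ * (Aᵀ * D) := by rw [← Matrix.mul_assoc, hiAT, one_mul]
      _ = (A⁻¹)ᵀ * Cᵀ * B + (A⁻¹)ᵀ := by rw [sub_eq_iff_eq_add.1 hAD]; noncomm_ring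
      _ = _ := by rw [hCA]
  convert ((NonnegReachable.lower hL).mul (NonnegReachable.blockDiagonal hA)).mul
    (NonnegReachable.upper hU) using 1
  simp only [fromBlocks_multiply, Matrix.one_mul, Matrix.mul_one, Matrix.zero_mul,
    Matrix.mul_zero, add_zero, zero_add]
  congr 1
  · rw [← Matrix.mul_assoc, hAi, one_mul]
  · rw [Matrix.mul_assoc, hiA, mul_one]
  · rw [hD, Matrix.mul_assoc C A⁻¹ A, hiA, mul_one, Matrix.mul_assoc]

theorem nonnegReachable_of_mem {M : Matrix (l ⊕ l) (l ⊕ l) ℝ} (hM : M ∈ symplecticGroup l ℝ) :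
    NonnegReachable M := by
  obtain ⟨A, B, C, D, rfl⟩ : ∃ A B C D, M = fromBlocks A B C D :=
    ⟨_, _, _, _, (fromBlocks_toBlocks M).symm⟩
  obtain ⟨x, hx⟩ := exists_det_add_smul_ne_zero hM
  have hmul : fromBlocks 1 (x • 1) 0 1 * fromBlocks A B C D =
      fromBlocks (A + x • C) (B + x • D) C D := by
    simp [fromBlocks_multiply]
  have hmem : fromBlocks (A + x • C) (B + x • D) C D ∈ symplecticGroup l ℝ := by
    rw [← hmul]
    exact mul_mem (by simp [fromBlocks_mem_iff]) hM
  have hs : ((-x) • (1 : Matrix l l ℝ)).IsSymm := isSymm_one.smul _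
  convert (NonnegReachable.upper hs).mul (nonnegReachable_of_det_ne_zero hmem hx) using 1
  simp [fromBlocks_multiply]

end SymplecticGroup

/-- Non-negative paths in `Sp(2n, ℝ)`: every symplectic matrix `M` can be joined
to the identity by a smooth path `β` of symplectic matrices whose logarithmic
derivative `−J·β'(t)·β(t)⁻¹` is symmetric positive semidefinite for all `t ∈ [0,1]`. -/
theorem exists_nonneg_symplectic_path (n : ℕ) (hn : 1 ≤ n)
    (M : Matrix (Fin n ⊕ Fin n) (Fin n ⊕ Fin n) ℝ)
    (hM : Mᵀ * Matrix.fromBlocks 0 (-1) 1 0 * M = Matrix.fromBlocks 0 (-1) 1 0) :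
    ∃ β : ℝ → Matrix (Fin n ⊕ Fin n) (Fin n ⊕ Fin n) ℝ,
      (∀ i j, ContDiff ℝ (⊤ : ℕ∞) (fun t => β t i j)) ∧
      (∀ t ∈ Set.Icc (0 : ℝ) 1,
        (β t)ᵀ * Matrix.fromBlocks 0 (-1) 1 0 * β t = Matrix.fromBlocks 0 (-1) 1 0) ∧
      β 0 = 1 ∧ β 1 = M ∧
      (∀ t ∈ Set.Icc (0 : ℝ) 1,
        (-(Matrix.fromBlocks 0 (-1) 1 0 *
            (Matrix.of fun i j => deriv (fun s => β s i j) t) * (β t)⁻¹)).PosSemidef) := by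
  obtain ⟨β, S, hβ, hβs, hS, hd, h0, h1⟩ :=
    SymplecticGroup.nonnegReachable_of_mem (SymplecticGroup.mem_iff'.2 hM)
  refine ⟨β, hβ, fun t _ => SymplecticGroup.mem_iff'.1 (hβs t), h0, h1, fun t _ => ?_⟩
  have hderiv : (Matrix.of fun i j => deriv (fun s => β s i j) t) = J (Fin n) ℝ * S t * β t := by
    ext i j
    exact (hd t i j).deriv
  change (-(J (Fin n) ℝ * _ * _)).PosSemidef
  rw [hderiv, Matrix.mul_assoc, Matrix.mul_assoc (J (Fin n) ℝ * S t),
    mul_nonsing_inv _ (SymplecticGroup.symplectic_det (hβs t)), Matrix.mul_one,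
    ← Matrix.mul_assoc, J_squared]
  simpa using hS t
end
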